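/- arXiv:1512.08494 — 2 statements merged into one kernel-verified Lean document; each statement's English description precedes it below -/
import Mathlib

section
/- Let n, k ∈ ℕ with 3 ≤ k ≤ n−1, let {D_I}, indexed by the k-subsets I of [n], be an l-treelike family of real numbers, and let 𝒫 be the unique internal-nonzero-weighted essential pseudostar of kind (n,k) with leaf set [n] realizing the family. Then every weighted essential tree with leaf set [n] realizing the family {D_I} can be obtained from 𝒫 by a finite sequence of k-OI operations and insertions of internal edges of weight 0. -/
/-- A weighted finite tree with leaf set labelled by `Fin n`:
a finite vertex type `V`, a tree `G` on `V`, an injective labelling `leaf` of the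
degree-one vertices by `Fin n` (every vertex of degree one is a labelled leaf),
and a weight function `w` on edges (zero off the edge set). -/
structure WTree (n : ℕ) where
  V : Type
  fintypeV : Fintype V
  G : SimpleGraph V
  isTree : G.IsTree
  leaf : Fin n → V
  leafInj : Function.Injective leaf
  leafSpec : ∀ v : V, (G.neighborSet v).ncard = 1 ↔ v ∈ Set.range leaf
  w : Sym2 V → ℝ
  wSupport : ∀ e, e ∉ G.edgeSet → w e = 0

namespace WTree

variable {n : ℕ}

/-- The degree of a vertex. -/
noncomputable def deg (T : WTree n) (v : T.V) : ℕ := (T.G.neighborSet v).ncard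

/-- A node is a vertex of degree `> 2`. -/
def IsNode (T : WTree n) (v : T.V) : Prop := 2 < T.deg v

/-- A tree is essential if it has no vertices of degree `2`. -/
def Essential (T : WTree n) : Prop := ∀ v : T.V, T.deg v ≠ 2

/-- The set of edges lying on the path between two vertices. -/
def pathEdges (T : WTree n) (u v : T.V) : Set (Sym2 T.V) :=
  {e | ∃ p : T.G.Walk u v, p.IsPath ∧ e ∈ p.edges}

/-- The edge set of the minimal subtree containing the leaves in `S`. -/
def subtreeEdges (T : WTree n) (S : Set (Fin n)) : Set (Sym2 T.V) :=
  {e | ∃ i ∈ S, ∃ j ∈ S, e ∈ T.pathEdges (T.leaf i) (T.leaf j)}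

/-- `D_I(T)`: the weight of the minimal subtree of `T` containing the leaves in `I`. -/
noncomputable def D (T : WTree n) (I : Finset (Fin n)) : ℝ :=
  ∑ᶠ e ∈ T.subtreeEdges ↑I, T.w e

/-- The total weight of the tree. -/
noncomputable def Dtot (T : WTree n) : ℝ := ∑ᶠ e ∈ T.G.edgeSet, T.w e

/-- An edge is a twig edge if it lies on the path from some leaf to the nearest node. -/
def IsTwigEdge (T : WTree n) (e : Sym2 T.V) : Prop :=
  ∃ (i : Fin n) (v : T.V), T.IsNode v ∧
    ∃ p : T.G.Walk (T.leaf i) v, p.IsPath ∧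
      (∀ u ∈ p.support, T.IsNode u → u = v) ∧ e ∈ p.edges

/-- Internal-nonzero-weighted: every internal (non-twig) edge has nonzero weight. -/
def InternalNonzero (T : WTree n) : Prop :=
  ∀ e ∈ T.G.edgeSet, ¬ T.IsTwigEdge e → T.w e ≠ 0

/-- Positive-weighted: all edge weights are positive. -/
def PositiveWeighted (T : WTree n) : Prop := ∀ e ∈ T.G.edgeSet, 0 < T.w e

/-- The leaves lying on the side of vertex `a` after removing the edge `e`. -/
def sideLeaves (T : WTree n) (e : Sym2 T.V) (a : T.V) : Set (Fin n) :=
  {i | e ∉ T.pathEdges (T.leaf i) a}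

/-- A pseudostar of kind `(n, k)`: every edge divides the leaf set into two parts,
at least one of which has cardinality `≥ k`. -/
def IsPseudostar (T : WTree n) (k : ℕ) : Prop :=
  ∀ a b : T.V, T.G.Adj a b →
    k ≤ (T.sideLeaves s(a, b) a).ncard ∨ k ≤ (T.sideLeaves s(a, b) b).ncard

/-- `T` realizes the family `D₀` of `k`-weights. -/
def Realizes (T : WTree n) (k : ℕ) (D₀ : Finset (Fin n) → ℝ) : Prop :=
  ∀ I : Finset (Fin n), I.card = k → T.D I = D₀ I

/-- Two leaves are neighbours if the path between them contains exactly one node. -/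
def Neighbours (T : WTree n) (i j : Fin n) : Prop :=
  i ≠ j ∧ ∃ p : T.G.Walk (T.leaf i) (T.leaf j), p.IsPath ∧
    ∃! v : T.V, v ∈ p.support ∧ T.IsNode v

/-- The Buneman index `⟨i,j | l,m⟩` holds iff the paths `i–j` and `l–m` are disjoint,
equivalently in `T|_{i,j,l,m}` the leaves `i,j` are neighbours, `l,m` are neighbours
and `i,l` are not neighbours. -/
def Buneman (T : WTree n) (i j l m : Fin n) : Prop :=
  ∀ (p : T.G.Walk (T.leaf i) (T.leaf j)) (q : T.G.Walk (T.leaf l) (T.leaf m)),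
    p.IsPath → q.IsPath → ∀ v : T.V, v ∈ p.support → v ∉ q.support

/-- The minimal subtree spanned by the four leaves `i,j,l,m` is a star (i.e. all
pairwise paths share a common vertex). -/
def StarQuartet (T : WTree n) (i j l m : Fin n) : Prop :=
  ∃ c : T.V, ∀ x ∈ ({i, j, l, m} : Set (Fin n)), ∀ y ∈ ({i, j, l, m} : Set (Fin n)),
    x ≠ y → ∀ p : T.G.Walk (T.leaf x) (T.leaf y), p.IsPath → c ∈ p.support

/-- A cherry: a set of leaves pairwise neighbours. -/
def IsCherry (T : WTree n) (C : Set (Fin n)) : Prop :=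
  ∀ i ∈ C, ∀ j ∈ C, i ≠ j → T.Neighbours i j

/-- A complete cherry: a cherry not strictly contained in another cherry. -/
def IsCompleteCherry (T : WTree n) (C : Set (Fin n)) : Prop :=
  T.IsCherry C ∧ ¬ ∃ C' : Set (Fin n), T.IsCherry C' ∧ C ⊂ C'

/-- A star is a tree with only one node. -/
def IsStar (T : WTree n) : Prop := ∃! v : T.V, T.IsNode v

/-- `x` is the median of the three leaves `a,b,c`: it lies on all three pairwise paths. -/
def IsMedian (T : WTree n) (a b c : Fin n) (x : T.V) : Prop :=
  (∀ p : T.G.Walk (T.leaf a) (T.leaf b), p.IsPath → x ∈ p.support) ∧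
  (∀ p : T.G.Walk (T.leaf a) (T.leaf c), p.IsPath → x ∈ p.support) ∧
  (∀ p : T.G.Walk (T.leaf b) (T.leaf c), p.IsPath → x ∈ p.support)

/-- The weight of the twig associated to the leaf `i` (the path from the leaf to the
nearest node). -/
noncomputable def twigWeight (T : WTree n) (i : Fin n) : ℝ :=
  ∑ᶠ e ∈ {e : Sym2 T.V | ∃ v : T.V, T.IsNode v ∧
      ∃ p : T.G.Walk (T.leaf i) v, p.IsPath ∧
        (∀ u ∈ p.support, T.IsNode u → u = v) ∧ e ∈ p.edges}, T.w e

/-- Two weighted trees with leaf set `Fin n` are equal (isomorphic respecting the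
leaf labels and the weights). -/
def Isom (T T' : WTree n) : Prop :=
  ∃ φ : T.V ≃ T'.V,
    (∀ a b : T.V, T.G.Adj a b ↔ T'.G.Adj (φ a) (φ b)) ∧
    (∀ i : Fin n, φ (T.leaf i) = T'.leaf i) ∧
    (∀ a b : T.V, T.w s(a, b) = T'.w s(φ a, φ b))

/-- `T'` is obtained from `T` by the `k`-IO operation on the edge `{a, b}`:
the edge divides the leaf set into two parts each of cardinality `< k`; it is
contracted (via the quotient map `φ`) and `w{a,b}/k` is added to the weight of
every twig (i.e. to every pendant edge). -/
def IOStepOn (k : ℕ) (T T' : WTree n) (a b : T.V) : Prop :=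
  T.G.Adj a b ∧
  (T.sideLeaves s(a, b) a).ncard < k ∧ (T.sideLeaves s(a, b) b).ncard < k ∧
  ∃ φ : T.V → T'.V,
    Function.Surjective φ ∧ φ a = φ b ∧
    (∀ x y : T.V, φ x = φ y → x = y ∨ s(x, y) = s(a, b)) ∧
    (∀ i : Fin n, φ (T.leaf i) = T'.leaf i) ∧
    (∀ u v : T'.V, T'.G.Adj u v ↔
      ∃ x y : T.V, φ x = u ∧ φ y = v ∧ T.G.Adj x y ∧ s(x, y) ≠ s(a, b)) ∧
    (∀ x y : T.V, T.G.Adj x y → s(x, y) ≠ s(a, b) →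
      ((∃ i : Fin n, T.leaf i = x ∨ T.leaf i = y) →
        T'.w s(φ x, φ y) = T.w s(x, y) + T.w s(a, b) / k) ∧
      (¬ (∃ i : Fin n, T.leaf i = x ∨ T.leaf i = y) →
        T'.w s(φ x, φ y) = T.w s(x, y)))

/-- `T'` is obtained from `T` by a `k`-IO operation. -/
def IOStep (k : ℕ) (T T' : WTree n) : Prop := ∃ a b : T.V, IOStepOn k T T' a b

/-- `T'` is obtained from `T` by a `k`-OI operation (the inverse of a `k`-IO operation). -/
def OIStep (k : ℕ) (T T' : WTree n) : Prop := IOStep k T' T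

/-- `T'` is obtained from `T` by inserting an internal edge of weight `0`
(the inverse of contracting it). -/
def InsertZeroStep (T T' : WTree n) : Prop :=
  ∃ a b : T'.V, T'.G.Adj a b ∧ ¬ T'.IsTwigEdge s(a, b) ∧ T'.w s(a, b) = 0 ∧
    ∃ φ : T'.V → T.V,
      Function.Surjective φ ∧ φ a = φ b ∧
      (∀ x y : T'.V, φ x = φ y → x = y ∨ s(x, y) = s(a, b)) ∧
      (∀ i : Fin n, φ (T'.leaf i) = T.leaf i) ∧
      (∀ u v : T.V, T.G.Adj u v ↔
        ∃ x y : T'.V, φ x = u ∧ φ y = v ∧ T'.G.Adj x y ∧ s(x, y) ≠ s(a, b)) ∧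
      (∀ x y : T'.V, T'.G.Adj x y → s(x, y) ≠ s(a, b) → T.w s(φ x, φ y) = T'.w s(x, y))

/-- Replace the weight function of `T`. -/
def reweight (T : WTree n) (w' : Sym2 T.V → ℝ)
    (h : ∀ e, e ∉ T.G.edgeSet → w' e = 0) : WTree n :=
  { T with w := w', wSupport := h }

end WTree

namespace SimpleGraph

variable {V : Type*} {G : SimpleGraph V}

/-- The edge `e` separates `x` from `y` if deleting it disconnects them. -/
def Separates (G : SimpleGraph V) (e : Sym2 V) (x y : V) : Prop :=
  ¬ (G.deleteEdges {e}).Reachable x y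

/-- The vertex `v` is the median of the three vertices `t 0`, `t 1`, `t 2`: no edge separates
two of them from `v`. -/
def IsMed (G : SimpleGraph V) (t : Fin 3 → V) (v : V) : Prop :=
  ∀ e, ∀ s s', s ≠ s' → G.Separates e (t s) v → ¬ G.Separates e (t s') v

namespace Separates

@[simp] theorem irrefl (e : Sym2 V) (x : V) : ¬ G.Separates e x x := fun h => h (Reachable.refl x)

theorem symm {e : Sym2 V} {x y : V} (h : G.Separates e x y) : G.Separates e y x :=
  fun h' => h h'.symm

theorem comm {e : Sym2 V} {x y : V} : G.Separates e x y ↔ G.Separates e y x := ⟨symm, symm⟩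

theorem of_left {e : Sym2 V} {x y z : V} (h : G.Separates e x z) (hxy : ¬ G.Separates e x y) :
    G.Separates e y z :=
  fun h' => h ((not_not.mp hxy).trans h')

theorem congr_left {e : Sym2 V} {x y z : V} (hxy : ¬ G.Separates e x y) :
    G.Separates e x z ↔ G.Separates e y z :=
  ⟨fun h => h.of_left hxy, fun h => h.of_left fun h' => hxy h'.symm⟩

theorem congr_right {e : Sym2 V} {x y z : V} (hxy : ¬ G.Separates e x y) :
    G.Separates e z x ↔ G.Separates e z y := by
  rw [comm, congr_left hxy, comm]

theorem mem_edges {e : Sym2 V} {x y : V} (h : G.Separates e x y) (p : G.Walk x y) :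
    e ∈ p.edges := by
  by_contra hp
  exact h ⟨p.toDeleteEdge e hp⟩

theorem mem_edgeSet (hG : G.Connected) {e : Sym2 V} {x y : V} (h : G.Separates e x y) :
    e ∈ G.edgeSet := by
  obtain ⟨p⟩ := hG.preconnected x y
  exact p.edges_subset_edgeSet (h.mem_edges p)

theorem adj_iff (hG : G.IsTree) {e : Sym2 V} {x y : V} (hxy : G.Adj x y) :
    G.Separates e x y ↔ e = s(x, y) := by
  constructor
  · intro h
    simpa using h.mem_edges hxy.toWalk
  · rintro rfl
    exact isBridge_iff.mp (isAcyclic_iff_forall_adj_isBridge.mp hG.isAcyclic hxy)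

theorem reachable_or (hG : G.Connected) (a b x : V) :
    (G.deleteEdges {s(a, b)}).Reachable x a ∨ (G.deleteEdges {s(a, b)}).Reachable x b := by
  obtain ⟨p⟩ := hG.preconnected x a
  induction p with
  | nil => exact .inl (Reachable.refl _)
  | @cons u v w h p ih =>
    by_cases he : s(u, v) = s(w, b)
    · rcases Sym2.eq_iff.mp he with ⟨rfl, rfl⟩ | ⟨rfl, rfl⟩
      · exact .inl (Reachable.refl _)
      · exact .inr (Reachable.refl _)
    · have : (G.deleteEdges {s(w, b)}).Reachable u v := by
        apply Adj.reachable
        simp only [deleteEdges_adj, Set.mem_singleton_iff]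
        exact ⟨h, he⟩
      exact ih.imp this.trans this.trans

/-- Deleting an edge leaves at most two components. -/
theorem not_of_of (hG : G.Connected) {e : Sym2 V} {x y z : V} (h : G.Separates e x y)
    (h' : G.Separates e y z) : ¬ G.Separates e x z := by
  induction e with | _ a b
  intro h2
  rcases reachable_or hG a b x with hx | hx <;> rcases reachable_or hG a b y with hy | hy <;>
    rcases reachable_or hG a b z with hz | hz
  all_goals first
    | exact h (hx.trans hy.symm)
    | exact h' (hy.trans hz.symm)
    | exact h2 (hx.trans hz.symm)

theorem right_iff (hG : G.Connected) {e : Sym2 V} {x y z : V} (h : G.Separates e x y) :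
    G.Separates e z y ↔ ¬ G.Separates e z x := by
  constructor
  · intro h1 h2
    exact not_of_of hG h2 h h1
  · intro h1
    exact h.of_left fun h2 => h1 h2.symm

theorem iff_not_iff (hG : G.Connected) {e : Sym2 V} {x u v : V} :
    G.Separates e u v ↔ ¬ (G.Separates e x u ↔ G.Separates e x v) := by
  by_cases h : G.Separates e u v
  · have := right_iff hG h (z := x)
    tauto
  · have := congr_right h (z := x)
    tauto

/-- An edge on one side of `g` does not separate vertices on the other side of `g`. -/
theorem not_of_side {g : Sym2 V} {a b x y : V} (hG : G.Connected)
    (hx : G.Separates g x a) (hy : G.Separates g y a) :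
    ¬ G.Separates s(a, b) x y := by
  classical
  have hxy : ¬ G.Separates g x y := not_of_of hG hx hy.symm
  obtain ⟨p⟩ := not_not.mp hxy
  intro h
  have hp := h.mem_edges (p.mapLe (deleteEdges_le _))
  rw [Walk.edges_mapLe_eq_edges] at hp
  exact hx ⟨p.takeUntil a (Walk.fst_mem_support_of_mem_edges p hp)⟩

/-- The splits of two edges are compatible. -/
theorem compatible (hG : G.IsTree) {e f : Sym2 V} {x y z w : V} (hxy : G.Separates e x y)
    (hfxy : ¬ G.Separates f x y) (hxz : G.Separates f x z) (hfzw : ¬ G.Separates f z w)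
    (hzw : G.Separates e z w) : False := by
  have hc := hG.connected
  induction e with | _ p q
  by_cases h : G.Separates f x p
  · exact not_of_side hc h ((congr_left hfxy).mp h) hxy
  · have h1 : G.Separates f z p := (hxz.of_left h).symm
    exact not_of_side hc h1 ((congr_left hfzw).mp h1) hzw

theorem exists_of_ne (hG : G.IsTree) {u v : V} (h : u ≠ v) :
    ∃ x, G.Adj v x ∧ G.Separates s(v, x) u v := by
  obtain ⟨p, hp, -⟩ := hG.existsUnique_path v u
  cases p with
  | nil => exact absurd rfl h
  | @cons _ x _ hx p =>
    refine ⟨x, hx, ?_⟩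
    rw [Walk.cons_isPath_iff] at hp
    have h1 : ¬ G.Separates s(v, x) x u := by
      refine not_not.mpr ⟨p.toDeleteEdge _ fun h => hp.2 ?_⟩
      exact Walk.fst_mem_support_of_mem_edges p h
    exact (((adj_iff hG hx).mpr rfl).symm).of_left h1 |>.symm.symm

/-- Branches of a vertex through distinct neighbours are disjoint. -/
theorem not_of_branches (hG : G.IsTree) {v x y p q : V} (hx : G.Adj v x) (hy : G.Adj v y)
    (hxy : x ≠ y) (hp : G.Separates s(v, x) p v) (hq : G.Separates s(v, y) q v) {e : Sym2 V}
    (hep : G.Separates e p v) : ¬ G.Separates e q v := by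
  intro heq
  have hc := hG.connected
  have hne : s(v, x) ≠ s(v, y) := by
    rw [Ne, Sym2.congr_right]
    exact hxy
  have hyv : G.Separates s(v, y) y v := ((adj_iff hG hy).mpr rfl).symm
  have hvx : G.Separates s(v, x) v x := (adj_iff hG hx).mpr rfl
  have h1 : ¬ G.Separates s(v, x) q v := by
    intro h
    exact not_of_side (b := x) hc hq hyv
      ((congr_right fun h' => hne ((adj_iff hG hy).mp h')).mp h)
  by_cases hef : e = s(v, x)
  · exact h1 (hef ▸ heq)
  · have h2 : ¬ G.Separates e v x := fun h => hef ((adj_iff hG hx).mp h)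
    have h3 : ¬ G.Separates s(v, x) p x := not_of_of hc hp hvx
    exact compatible hG ((congr_right h2).mp hep) h3
      (hp.symm.of_left (fun h => h1 h.symm) |>.symm) h1 heq

/-- Every branch of a finite tree contains a vertex of degree one. -/
theorem exists_leaf_of_branch [Finite V] (hG : G.IsTree) {v x : V} (hx : G.Adj v x) :
    ∃ l, (G.neighborSet l).ncard = 1 ∧ G.Separates s(v, x) l v := by
  have hvx : G.Separates s(v, x) x v := ((adj_iff hG hx).mpr rfl).symm
  obtain ⟨l, hl, hmax⟩ := Set.exists_max_image {l | G.Separates s(v, x) l v}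
    (fun l => {e | G.Separates e v l}.ncard) (Set.toFinite _) ⟨x, hvx⟩
  refine ⟨l, ?_, hl⟩
  have hlv : l ≠ v := by rintro rfl; exact irrefl _ _ hl
  obtain ⟨m, hm, hms⟩ := exists_of_ne hG hlv.symm
  rw [Set.ncard_eq_one]
  refine ⟨m, Set.eq_singleton_iff_unique_mem.mpr ⟨hm, fun y hy => ?_⟩⟩
  by_contra hne
  have hy' : G.Adj l y := hy
  have hyl : G.Separates s(l, y) l y := (adj_iff hG hy').mpr rfl
  have hvl : ¬ G.Separates s(l, y) v l := not_of_branches hG hy' hm hne hyl.symm hms hyl.symm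
  have hbranch : ¬ G.Separates s(v, x) l y := fun h =>
    hvl ((adj_iff hG hy').mp h ▸ hl.symm)
  have hle := hmax y ((congr_left hbranch).mp hl)
  refine absurd hle (not_le.mpr (Set.ncard_lt_ncard (Set.ssubset_iff_of_subset ?_ |>.mpr
    ⟨s(l, y), ?_, hvl⟩) (Set.toFinite _)))
  · intro e he
    by_cases h : e = s(l, y)
    · exact absurd (h ▸ he) hvl
    · exact (congr_right fun h' => h ((adj_iff hG hy').mp h')).mp he
  · exact hyl.of_left fun h => hvl h.symm

theorem exists_isMed [Finite V] (hG : G.IsTree) (t : Fin 3 → V) : ∃ v, G.IsMed t v := by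
  have hc := hG.connected
  let bad : V → Set (Sym2 V) := fun v =>
    {e | ∃ s s', s ≠ s' ∧ G.Separates e (t s) v ∧ G.Separates e (t s') v}
  obtain ⟨v, -, hmin⟩ := Set.exists_min_image Set.univ (fun v => (bad v).ncard) (Set.toFinite _)
    ⟨t 0, trivial⟩
  refine ⟨v, fun e s s' hss hs hs' => ?_⟩
  have hne : t s ≠ v := by intro h; rw [h] at hs; exact irrefl _ _ hs
  obtain ⟨x, hx, hxs⟩ := exists_of_ne hG hne
  have hvx : G.Separates s(v, x) v x := (adj_iff hG hx).mpr rfl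
  have hxs' : G.Separates s(v, x) (t s') v := by
    by_cases h : s(v, x) = e
    · rwa [h]
    · exact hxs.of_left (not_of_side hc hs hs')
  refine absurd (hmin x trivial) (not_le.mpr (Set.ncard_lt_ncard
    (Set.ssubset_iff_of_subset ?_ |>.mpr ⟨s(v, x), ⟨s, s', hss, hxs, hxs'⟩, ?_⟩)
    (Set.toFinite _)))
  · rintro f ⟨r, r', hrr, hr, hr'⟩
    by_cases h : f = s(v, x)
    · subst h
      rw [right_iff hc hvx] at hr hr'
      have h1 : r ≠ s := by rintro rfl; exact hr hxs
      have h2 : r ≠ s' := by rintro rfl; exact hr hxs'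
      have h3 : r' ≠ s := by rintro rfl; exact hr' hxs
      have h4 : r' ≠ s' := by rintro rfl; exact hr' hxs'
      omega
    · have h' : ¬ G.Separates f v x := fun h' => h ((adj_iff hG hx).mp h')
      exact ⟨r, r', hrr, (congr_right h').mpr hr, (congr_right h').mpr hr'⟩
  · rintro ⟨r, r', hrr, hr, hr'⟩
    rw [right_iff hc hvx] at hr hr'
    have h1 : r ≠ s := by rintro rfl; exact hr hxs
    have h2 : r ≠ s' := by rintro rfl; exact hr hxs'
    have h3 : r' ≠ s := by rintro rfl; exact hr' hxs
    have h4 : r' ≠ s' := by rintro rfl; exact hr' hxs'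
    omega

end Separates

section Contraction

variable {V' : Type*} {G' : SimpleGraph V'} {φ : V → V'} {a b : V}

/-- `G'` arises from `G` by contracting `s(a, b)` along the quotient map `φ`. -/
structure IsContraction (G : SimpleGraph V) (G' : SimpleGraph V') (a b : V) (φ : V → V') :
    Prop where
  surjective : Function.Surjective φ
  map_eq : φ a = φ b
  fiber : ∀ x y, φ x = φ y → x = y ∨ s(x, y) = s(a, b)
  adj_iff : ∀ u v, G'.Adj u v ↔ ∃ x y, φ x = u ∧ φ y = v ∧ G.Adj x y ∧ s(x, y) ≠ s(a, b)

theorem exists_isContraction {V : Type} (G : SimpleGraph V) {a b : V} (hab : a ≠ b) :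
    ∃ (V' : Type) (G' : SimpleGraph V') (φ : V → V'), G.IsContraction G' a b φ := by
  classical
  let φ : V → {v // v ≠ b} := fun v => if h : v = b then ⟨a, hab⟩ else ⟨v, h⟩
  have hfib : ∀ x y, φ x = φ y → x = y ∨ s(x, y) = s(a, b) := by
    intro x y h
    by_cases hx : x = b <;> by_cases hy : y = b
    · exact .inl (hx.trans hy.symm)
    · simp only [φ, hx, hy, dite_true, dite_false, Subtype.mk.injEq] at h
      exact .inr (by rw [hx, ← h, Sym2.eq_swap])
    · simp only [φ, hx, hy, dite_true, dite_false, Subtype.mk.injEq] at h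
      exact .inr (by rw [hy, h])
    · simp only [φ, hx, hy, dite_false, Subtype.mk.injEq] at h
      exact .inl h
  refine ⟨_, { Adj := fun u v => ∃ x y, φ x = u ∧ φ y = v ∧ G.Adj x y ∧ s(x, y) ≠ s(a, b),
               symm := ⟨?_⟩, loopless := ⟨?_⟩ }, φ, ⟨?_, ?_, hfib, fun _ _ => Iff.rfl⟩⟩
  · rintro _ _ ⟨x, y, rfl, rfl, h, h'⟩
    exact ⟨y, x, rfl, rfl, h.symm, by rwa [Sym2.eq_swap]⟩
  · rintro _ ⟨x, y, rfl, h1, h, h'⟩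
    exact (hfib y x h1).elim h.ne' fun h2 => h' (Sym2.eq_swap.trans h2)
  · rintro ⟨v, hv⟩
    exact ⟨v, by simp [φ, hv]⟩
  · simp [φ, hab]

namespace IsContraction

theorem adj (h : G.IsContraction G' a b φ) {x y : V} (hxy : G.Adj x y) (hne : s(x, y) ≠ s(a, b)) :
    G'.Adj (φ x) (φ y) :=
  (h.adj_iff _ _).mpr ⟨x, y, rfl, rfl, hxy, hne⟩

theorem map_eq_of_edge (h : G.IsContraction G' a b φ) {x y : V} (hxy : s(x, y) = s(a, b)) :
    φ x = φ y := by
  rcases Sym2.eq_iff.mp hxy with ⟨rfl, rfl⟩ | ⟨rfl, rfl⟩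
  · exact h.map_eq
  · exact h.map_eq.symm

theorem not_separates (h : G.IsContraction G' a b φ) (hG : G.IsTree) (hab : G.Adj a b)
    {f : Sym2 V} (hf : f ≠ s(a, b)) {x y : V} (hxy : φ x = φ y) : ¬ G.Separates f x y := by
  rcases h.fiber x y hxy with rfl | he
  · exact Separates.irrefl _ _
  · have hadj : G.Adj x y := by rwa [← mem_edgeSet, he]
    rw [Separates.adj_iff hG hadj, he]
    exact hf

theorem edge_eq (h : G.IsContraction G' a b φ) (hG : G.IsTree) (hab : G.Adj a b)
    {x y x' y' : V} (hxy : G.Adj x y) (hne : s(x, y) ≠ s(a, b)) (hxy' : G.Adj x' y')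
    (hx : φ x = φ x') (hy : φ y = φ y') : s(x, y) = s(x', y') := by
  have h1 := (Separates.adj_iff hG hxy).mpr rfl
  rw [Separates.congr_left (h.not_separates hG hab hne hx),
    Separates.congr_right (h.not_separates hG hab hne hy)] at h1
  exact (Separates.adj_iff hG hxy').mp h1

theorem injOn_edges (h : G.IsContraction G' a b φ) (hG : G.IsTree) (hab : G.Adj a b) :
    Set.InjOn (Sym2.map φ) (G.edgeSet \ {s(a, b)}) := by
  rintro e ⟨he, hne⟩ f ⟨hf, -⟩ hef
  induction e with | _ x y
  induction f with | _ x' y'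
  simp only [Sym2.map_mk] at hef
  rcases Sym2.eq_iff.mp hef with ⟨h1, h2⟩ | ⟨h1, h2⟩
  · exact h.edge_eq hG hab he hne hf h1 h2
  · exact (h.edge_eq hG hab he hne (Adj.symm hf) h1 h2).trans Sym2.eq_swap

theorem map_mem_edgeSet (h : G.IsContraction G' a b φ) {e : Sym2 V} (he : e ∈ G.edgeSet)
    (hne : e ≠ s(a, b)) : Sym2.map φ e ∈ G'.edgeSet := by
  induction e with | _ x y
  exact h.adj he hne

theorem exists_map_eq (h : G.IsContraction G' a b φ) {e' : Sym2 V'} (he' : e' ∈ G'.edgeSet) :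
    ∃ e ∈ G.edgeSet, e ≠ s(a, b) ∧ Sym2.map φ e = e' := by
  induction e' with | _ u v
  obtain ⟨x, y, rfl, rfl, hxy, hne⟩ := (h.adj_iff _ _).mp he'
  exact ⟨s(x, y), hxy, hne, rfl⟩

theorem separates_iff (h : G.IsContraction G' a b φ) (hG : G.IsTree) (hab : G.Adj a b)
    {e : Sym2 V} (he : e ∈ G.edgeSet) (hne : e ≠ s(a, b)) {u v : V} :
    G'.Separates (Sym2.map φ e) (φ u) (φ v) ↔ G.Separates e u v := by
  refine not_congr ⟨?_, ?_⟩
  · rintro ⟨p⟩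
    suffices ∀ {u' v'}, (G'.deleteEdges {Sym2.map φ e}).Walk u' v' →
        ∀ u v, φ u = u' → φ v = v' → ¬ G.Separates e u v from not_not.mp (this p u v rfl rfl)
    intro u' v' p
    induction p with
    | nil => exact fun u v hu hv => h.not_separates hG hab hne (hu.trans hv.symm)
    | cons hadj p ih =>
      intro u v hu hv
      rw [deleteEdges_adj, Set.mem_singleton_iff] at hadj
      obtain ⟨x, y, rfl, rfl, hxy, -⟩ := (h.adj_iff _ _).mp hadj.1
      have h1 : ¬ G.Separates e x y := by
        rw [Separates.adj_iff hG hxy]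
        rintro rfl
        exact hadj.2 rfl
      rw [Separates.congr_left (h.not_separates hG hab hne hu), Separates.congr_left h1]
      exact ih y v rfl hv
  · rintro ⟨p⟩
    induction p with
    | nil => exact Reachable.refl _
    | @cons u w v hadj p ih =>
      refine Reachable.trans ?_ ih
      rw [deleteEdges_adj, Set.mem_singleton_iff] at hadj
      by_cases h0 : s(u, w) = s(a, b)
      · rw [h.map_eq_of_edge h0]
      · refine Adj.reachable ?_
        rw [deleteEdges_adj, Set.mem_singleton_iff]
        refine ⟨h.adj hadj.1 h0, fun heq => hadj.2 ?_⟩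
        exact h.injOn_edges hG hab ⟨hadj.1, h0⟩ ⟨he, hne⟩ heq

theorem isTree (h : G.IsContraction G' a b φ) (hG : G.IsTree) (hab : G.Adj a b) : G'.IsTree := by
  refine ⟨?_, ?_⟩
  · have : Nonempty V' := ⟨φ a⟩
    refine ⟨fun u v => ?_⟩
    obtain ⟨u, rfl⟩ := h.surjective u
    obtain ⟨v, rfl⟩ := h.surjective v
    obtain ⟨p⟩ := hG.connected.preconnected u v
    induction p with
    | nil => exact Reachable.refl _
    | @cons u w v hadj p ih =>
      refine Reachable.trans ?_ ih
      by_cases h0 : s(u, w) = s(a, b)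
      · rw [h.map_eq_of_edge h0]
      · exact (h.adj hadj h0).reachable
  · rw [isAcyclic_iff_forall_adj_isBridge]
    intro u v huv
    obtain ⟨x, y, rfl, rfl, hxy, hne⟩ := (h.adj_iff _ _).mp huv
    rw [isBridge_iff]
    exact (h.separates_iff hG hab (e := s(x, y)) hxy hne).mpr ((Separates.adj_iff hG hxy).mpr rfl)

theorem ncard_neighborSet (h : G.IsContraction G' a b φ) (hG : G.IsTree) (hab : G.Adj a b)
    {x : V} (hxa : x ≠ a) (hxb : x ≠ b) :
    (G'.neighborSet (φ x)).ncard = (G.neighborSet x).ncard := by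
  have hne : ∀ y, s(x, y) ≠ s(a, b) := fun y hy => by
    rcases Sym2.eq_iff.mp hy with h | h
    · exact hxa h.1
    · exact hxb h.1
  have himage : G'.neighborSet (φ x) = φ '' G.neighborSet x := by
    ext v
    simp only [mem_neighborSet, h.adj_iff, Set.mem_image]
    constructor
    · rintro ⟨x', y, hx, rfl, hxy, h'⟩
      rcases h.fiber x' x hx with rfl | he
      · exact ⟨y, hxy, rfl⟩
      · exact absurd (Sym2.eq_swap.trans he) (hne x')
    · rintro ⟨y, hxy, rfl⟩
      exact ⟨x, y, rfl, rfl, hxy, hne y⟩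
  rw [himage, Set.InjOn.ncard_image]
  intro y hy y' hy' hyy
  exact Sym2.congr_right.mp (h.edge_eq hG hab hy (hne y) hy' rfl hyy)

theorem two_lt_ncard_neighborSet [Finite V'] (h : G.IsContraction G' a b φ) (hG : G.IsTree)
    (hab : G.Adj a b) (ha : 2 < (G.neighborSet a).ncard) (hb : 1 < (G.neighborSet b).ncard) :
    2 < (G'.neighborSet (φ a)).ncard := by
  obtain ⟨y, y', hy, hyb, hy', hyb', hyy⟩ : ∃ y y', G.Adj a y ∧ y ≠ b ∧ G.Adj a y' ∧ y' ≠ b ∧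
      y ≠ y' := by
    have h2 : 1 < (G.neighborSet a \ {b}).ncard := by
      rw [Set.ncard_sdiff_singleton_of_mem (show b ∈ G.neighborSet a from hab)]
      omega
    obtain ⟨x, ⟨hx, hxb⟩, y, ⟨hy, hyb⟩, hxy⟩ :=
      (Set.one_lt_ncard (Set.finite_of_ncard_pos (by omega))).mp h2
    exact ⟨x, y, hx, hxb, hy, hyb, hxy⟩
  obtain ⟨z, hz, hza⟩ := Set.exists_ne_of_one_lt_ncard hb a
  have hne : ∀ {y}, y ≠ b → s(a, y) ≠ s(a, b) := fun hy h => hy (Sym2.congr_right.mp h)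
  have hnz : s(b, z) ≠ s(a, b) := fun h => hza (Sym2.congr_right.mp (h.trans Sym2.eq_swap))
  have hz' : ∀ {y}, G.Adj a y → y ≠ b → φ y ≠ φ z := fun hy hyb hyz => by
    rcases Sym2.eq_iff.mp (h.edge_eq hG hab hy (hne hyb) hz h.map_eq hyz) with h | h
    · exact hab.ne h.1
    · exact hza h.1.symm
  refine (Set.two_lt_ncard (Set.toFinite _)).mpr ⟨φ y, h.adj hy (hne hyb), φ y',
    h.adj hy' (hne hyb'), φ z, ?_, fun he => hyy ?_, hz' hy hyb, hz' hy' hyb'⟩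
  · rw [mem_neighborSet, h.map_eq]
    exact h.adj hz hnz
  · exact Sym2.congr_right.mp (h.edge_eq hG hab hy (hne hyb) hy' rfl he)

end IsContraction

end Contraction

end SimpleGraph

namespace WTree

open SimpleGraph

variable {n : ℕ}

instance (T : WTree n) : Fintype T.V := T.fintypeV

/-- The edge `e` separates the leaves `i` and `j`. -/
def LSep (T : WTree n) (e : Sym2 T.V) (i j : Fin n) : Prop :=
  T.G.Separates e (T.leaf i) (T.leaf j)

/-- The vertex `v` lies on the path between the leaves `i` and `j`. -/
def Across (T : WTree n) (v : T.V) (i j : Fin n) : Prop :=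
  ∀ e, T.G.Separates e (T.leaf i) v → ¬ T.G.Separates e (T.leaf j) v

theorem connected (T : WTree n) : T.G.Connected := T.isTree.connected

theorem mem_pathEdges (T : WTree n) {e : Sym2 T.V} {u v : T.V} :
    e ∈ T.pathEdges u v ↔ T.G.Separates e u v := by
  constructor
  · rintro ⟨p, hp, he⟩
    intro hr
    classical
    obtain ⟨q, hq⟩ := hr.exists_isPath
    have h := (T.isTree.isAcyclic.subsingleton_path u v).elim ⟨p, hp⟩
      ⟨q.mapLe (deleteEdges_le _), hq.mapLe _⟩
    rw [Subtype.mk.injEq] at h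
    rw [h, Walk.edges_mapLe_eq_edges] at he
    have := q.edges_subset_edgeSet he
    simp at this
  · intro h
    obtain ⟨p, hp, -⟩ := T.isTree.existsUnique_path u v
    exact ⟨p, hp, h.mem_edges p⟩

theorem mem_sideLeaves (T : WTree n) {e : Sym2 T.V} {a : T.V} {i : Fin n} :
    i ∈ T.sideLeaves e a ↔ ¬ T.G.Separates e (T.leaf i) a := by
  rw [← mem_pathEdges]; rfl

theorem three_le_deg (T : WTree n) (hn : 2 ≤ n) (hT : T.Essential) {v : T.V}
    (hv : v ∉ Set.range T.leaf) : 3 ≤ T.deg v := by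
  have h1 : T.deg v ≠ 1 := fun h => hv ((T.leafSpec v).mp h)
  have h2 := hT v
  have h0 : T.deg v ≠ 0 := by
    intro h
    rw [deg, Set.ncard_eq_zero (Set.toFinite _)] at h
    have hne : T.leaf ⟨0, by omega⟩ ≠ v := fun h => hv ⟨_, h⟩
    obtain ⟨x, hx, -⟩ := Separates.exists_of_ne T.isTree hne
    exact Set.notMem_empty x (h ▸ hx)
  omega

theorem exists_leaf_of_adj (T : WTree n) {v x : T.V} (hx : T.G.Adj v x) :
    ∃ i, T.G.Separates s(v, x) (T.leaf i) v := by
  obtain ⟨l, hl, h⟩ := Separates.exists_leaf_of_branch T.isTree hx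
  obtain ⟨i, rfl⟩ := (T.leafSpec l).mp hl
  exact ⟨i, h⟩

theorem exists_isMed_leaf (T : WTree n) (hn : 2 ≤ n) (hT : T.Essential) (v : T.V) :
    ∃ t : Fin 3 → Fin n, T.G.IsMed (T.leaf ∘ t) v := by
  by_cases hv : v ∈ Set.range T.leaf
  · obtain ⟨i, rfl⟩ := hv
    exact ⟨fun _ => i, fun e s s' _ h => absurd h (Separates.irrefl _ _)⟩
  · have h3 := T.three_le_deg hn hT hv
    obtain ⟨x, hx, y, hy, z, hz, hxy, hxz, hyz⟩ := (Set.two_lt_ncard (Set.toFinite _)).mp h3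
    let nb : Fin 3 → T.V := ![x, y, z]
    have hadj : ∀ s, T.G.Adj v (nb s) := by
      intro s; fin_cases s <;> assumption
    have hinj : ∀ s s', s ≠ s' → nb s ≠ nb s' := by
      intro s s' h
      fin_cases s <;> fin_cases s' <;> simp_all [nb, eq_comm]
    choose t ht using fun s => T.exists_leaf_of_adj (hadj s)
    exact ⟨t, fun e s s' h hs => Separates.not_of_branches T.isTree (hadj s) (hadj s')
      (hinj s s' h) (ht s) (ht s') hs⟩

/-- The edge at a leaf separates it from every other vertex. -/
theorem separates_of_leaf (T : WTree n) {i : Fin n} {b x : T.V} (h : T.G.Adj (T.leaf i) b)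
    (hx : x ≠ T.leaf i) : T.G.Separates s(T.leaf i, b) x (T.leaf i) := by
  obtain ⟨y, hy, hys⟩ := Separates.exists_of_ne T.isTree hx
  obtain ⟨c, hc⟩ := Set.ncard_eq_one.mp ((T.leafSpec (T.leaf i)).mpr ⟨i, rfl⟩)
  have h1 : y = c := by simpa [hc] using (show y ∈ T.G.neighborSet (T.leaf i) from hy)
  have h2 : b = c := by simpa [hc] using (show b ∈ T.G.neighborSet (T.leaf i) from h)
  rwa [h2, ← h1]

theorem not_adj_leaf_leaf (T : WTree n) (hn : 3 ≤ n) (i j : Fin n) :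
    ¬ T.G.Adj (T.leaf i) (T.leaf j) := by
  intro h
  obtain ⟨m, hm⟩ : ∃ m : Fin n, m ≠ i ∧ m ≠ j := by
    by_contra! hc
    have : (Finset.univ : Finset (Fin n)) ⊆ {i, j} := by
      intro m _
      simpa [or_iff_not_imp_left] using hc m
    have := (Finset.card_le_card this).trans Finset.card_le_two
    simp at this
    omega
  have h1 := T.separates_of_leaf h (fun h' => hm.1 (T.leafInj h'))
  have h2 := T.separates_of_leaf h.symm (fun h' => hm.2 (T.leafInj h'))
  rw [Sym2.eq_swap] at h2
  exact Separates.not_of_of T.connected h1.symm h2 ((Separates.adj_iff T.isTree h).mpr rfl)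

theorem isTwigEdge_iff (T : WTree n) (hn : 3 ≤ n) (hT : T.Essential) {a b : T.V}
    (hab : T.G.Adj a b) :
    T.IsTwigEdge s(a, b) ↔ a ∈ Set.range T.leaf ∨ b ∈ Set.range T.leaf := by
  have key : ∀ {a b : T.V}, T.G.Adj a b → a ∈ Set.range T.leaf → T.IsTwigEdge s(a, b) := by
    rintro a b hab ⟨i, rfl⟩
    refine ⟨i, b, T.three_le_deg (by omega) hT ?_, hab.toWalk, ?_, ?_, ?_⟩
    · rintro ⟨j, rfl⟩
      exact T.not_adj_leaf_leaf hn i j hab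
    · simpa using hab.ne
    · intro u hu hnode
      simp only [Walk.support_cons, Walk.support_nil, List.mem_cons, List.not_mem_nil,
        or_false] at hu
      rcases hu with rfl | rfl
      · have := (T.leafSpec (T.leaf i)).mpr ⟨i, rfl⟩
        simp [IsNode, deg, this] at hnode
      · rfl
    · simp
  constructor
  · rintro ⟨i, v, -, p, -, hp, he⟩
    by_contra! h
    have ha := hp a (p.fst_mem_support_of_mem_edges he) (T.three_le_deg (by omega) hT h.1)
    have hb := hp b (p.snd_mem_support_of_mem_edges he) (T.three_le_deg (by omega) hT h.2)
    exact hab.ne (ha.trans hb.symm)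
  · rintro (h | h)
    · exact key hab h
    · rw [Sym2.eq_swap]
      exact key hab.symm h

/-- The edges of the tree. -/
noncomputable def edges (T : WTree n) : Finset (Sym2 T.V) := (Set.toFinite T.G.edgeSet).toFinset

@[simp] theorem mem_edges (T : WTree n) {e : Sym2 T.V} : e ∈ T.edges ↔ e ∈ T.G.edgeSet := by
  simp [edges]

theorem LSep.mem_edges {T : WTree n} {e : Sym2 T.V} {i j : Fin n} (h : T.LSep e i j) :
    e ∈ T.edges := T.mem_edges.mpr (Separates.mem_edgeSet T.connected h)

open Classical in
/-- The indicator of the event that `e` splits the set of leaves `I`. -/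
noncomputable def splits (T : WTree n) (e : Sym2 T.V) (I : Finset (Fin n)) : ℝ :=
  if ∃ i ∈ I, ∃ j ∈ I, T.LSep e i j then 1 else 0

theorem D_eq_sum (T : WTree n) (I : Finset (Fin n)) :
    T.D I = ∑ e ∈ T.edges, T.w e * T.splits e I := by
  classical
  have h : T.subtreeEdges ↑I =
      ((T.edges.filter fun e => ∃ i ∈ I, ∃ j ∈ I, T.LSep e i j : Finset _) : Set (Sym2 T.V)) := by
    ext e
    simp only [subtreeEdges, mem_pathEdges, Set.mem_ofPred_eq, Finset.mem_coe, Finset.mem_filter]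
    constructor
    · rintro ⟨i, hi, j, hj, h⟩
      exact ⟨LSep.mem_edges h, i, hi, j, hj, h⟩
    · exact fun h => h.2
  rw [D, h, finsum_mem_coe_finset, Finset.sum_filter]
  simp [splits]

/-- The edges `e` and `f` of two trees induce the same split of the leaves. -/
def SameSplit (T T' : WTree n) (e : Sym2 T.V) (f : Sym2 T'.V) : Prop :=
  ∀ i j, T.LSep e i j ↔ T'.LSep f i j

/-- Every split of `T` is a split of `T'`. -/
def SplitsIn (T T' : WTree n) : Prop :=
  ∀ e ∈ T.G.edgeSet, ∃ f ∈ T'.G.edgeSet, T.SameSplit T' e f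

/-- The vertices `v` and `v'` of two trees lie on the same side of each common split. -/
def Corresponds (T T' : WTree n) (v : T.V) (v' : T'.V) : Prop :=
  ∀ e e', T.SameSplit T' e e' → ∀ i,
    T.G.Separates e (T.leaf i) v ↔ T'.G.Separates e' (T'.leaf i) v'

theorem SameSplit.symm {T T' : WTree n} {e : Sym2 T.V} {e' : Sym2 T'.V}
    (h : T.SameSplit T' e e') : T'.SameSplit T e' e := fun i j => (h i j).symm

theorem Corresponds.symm {T T' : WTree n} {v : T.V} {v' : T'.V}
    (h : T.Corresponds T' v v') : T'.Corresponds T v' v :=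
  fun e e' he i => (h e' e he.symm i).symm

theorem corresponds_of_isMed {T T' : WTree n} {v : T.V} {v' : T'.V} {t : Fin 3 → Fin n}
    (h : T.G.IsMed (T.leaf ∘ t) v) (h' : T'.G.IsMed (T'.leaf ∘ t) v') :
    T.Corresponds T' v v' := by
  intro e e' he i
  have h1 := h e
  have h2 := h' e'
  obtain ⟨s, hs, hs'⟩ : ∃ s, ¬ T.G.Separates e (T.leaf (t s)) v ∧
      ¬ T'.G.Separates e' (T'.leaf (t s)) v' := by
    by_contra! hc
    have a01 := h1 0 1 (by decide)
    have a02 := h1 0 2 (by decide)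
    have a12 := h1 1 2 (by decide)
    have b01 := h2 0 1 (by decide)
    have b02 := h2 0 2 (by decide)
    have b12 := h2 1 2 (by decide)
    have c0 := hc 0
    have c1 := hc 1
    have c2 := hc 2
    simp only [Function.comp] at *
    tauto
  rw [← Separates.congr_right hs, ← Separates.congr_right hs']
  exact he i (t s)

theorem exists_corresponds (T T' : WTree n) (hn : 2 ≤ n) (hT : T.Essential) (v : T.V) :
    ∃ v', T.Corresponds T' v v' := by
  obtain ⟨t, ht⟩ := T.exists_isMed_leaf hn hT v
  obtain ⟨v', hv'⟩ := Separates.exists_isMed T'.isTree (T'.leaf ∘ t)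
  exact ⟨v', corresponds_of_isMed ht hv'⟩

theorem Corresponds.separates_iff {T T' : WTree n} (hn : 2 ≤ n) {u v : T.V} {u' v' : T'.V}
    (hu : T.Corresponds T' u u') (hv : T.Corresponds T' v v') {e : Sym2 T.V} {e' : Sym2 T'.V}
    (he : T.SameSplit T' e e') : T.G.Separates e u v ↔ T'.G.Separates e' u' v' := by
  have hu := hu e e' he ⟨0, by omega⟩
  have hv := hv e e' he ⟨0, by omega⟩
  rw [Separates.iff_not_iff T.connected (x := T.leaf ⟨0, by omega⟩),
    Separates.iff_not_iff T'.connected (x := T'.leaf ⟨0, by omega⟩), hu, hv]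

theorem Corresponds.unique {T T' : WTree n} (hn : 2 ≤ n) (hs : T'.SplitsIn T) {u v : T.V}
    {u' v' : T'.V} (hu : T.Corresponds T' u u') (hv : T.Corresponds T' v v') (h : u = v) :
    u' = v' := by
  subst h
  by_contra hne
  obtain ⟨x, hx, hxs⟩ := Separates.exists_of_ne T'.isTree hne
  obtain ⟨e, -, he⟩ := hs s(v', x) hx
  exact Separates.irrefl e u ((hu.separates_iff hn hv he.symm).mpr hxs)

/-- Distinct edges of an essential tree induce distinct splits. -/
theorem SameSplit.eq {T : WTree n} (hn : 2 ≤ n) (hT : T.Essential) {e f : Sym2 T.V}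
    (he : e ∈ T.G.edgeSet) (h : T.SameSplit T e f) : e = f := by
  induction e with | _ p q
  have hcor : ∀ v, T.Corresponds T v v := fun v => by
    obtain ⟨t, ht⟩ := T.exists_isMed_leaf hn hT v
    exact corresponds_of_isMed ht ht
  have := ((hcor p).separates_iff hn (hcor q) h).mp ((Separates.adj_iff T.isTree he).mpr rfl)
  exact ((Separates.adj_iff T.isTree he).mp this).symm

theorem Corresponds.adj {T T' : WTree n} (hn : 2 ≤ n) (hT' : T'.Essential)
    (hs : T.SplitsIn T') (hs' : T'.SplitsIn T) {u v : T.V}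
    {u' v' : T'.V} (hu : T.Corresponds T' u u') (hv : T.Corresponds T' v v')
    (h : T.G.Adj u v) : T'.G.Adj u' v' := by
  obtain ⟨e', he', hse⟩ := hs s(u, v) h
  have huniq : ∀ f', T'.G.Separates f' v' u' → f' = e' := by
    intro f' hf'
    have hf := Separates.mem_edgeSet T'.connected hf'
    obtain ⟨f, -, hsf⟩ := hs' f' hf
    have h1 := (hu.separates_iff hn hv hsf.symm).mpr hf'.symm
    have h2 := (Separates.adj_iff T.isTree h).mp h1
    subst h2
    exact SameSplit.eq hn hT' hf fun i j => (hsf i j).trans (hse i j)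
  have hne : v' ≠ u' := by
    intro hvu
    have h1 := (hu.separates_iff hn hv hse).mp ((Separates.adj_iff T.isTree h).mpr rfl)
    rw [hvu] at h1
    exact Separates.irrefl _ _ h1
  obtain ⟨x, hx, hxs⟩ := Separates.exists_of_ne T'.isTree hne
  have hux : T'.G.Separates s(u', x) u' x := (Separates.adj_iff T'.isTree hx).mpr rfl
  by_cases hxv : x = v'
  · exact hxv ▸ hx
  · exfalso
    obtain ⟨y, hy, hys⟩ := Separates.exists_of_ne T'.isTree hxv
    have h1 : s(v', y) ≠ s(u', x) := by
      intro h1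
      rw [h1] at hys
      exact Separates.not_of_of T'.connected hxs hux hys.symm
    have h2 : ¬ T'.G.Separates s(v', y) x u' := fun h2 =>
      h1 ((Separates.adj_iff T'.isTree hx).mp h2.symm)
    exact h1 ((huniq _ (hys.of_left h2).symm).trans (huniq _ hxs).symm)

theorem isom_of_splitsIn {T T' : WTree n} (hn : 2 ≤ n) (hT : T.Essential) (hT' : T'.Essential)
    (hs : T.SplitsIn T') (hs' : T'.SplitsIn T)
    (hw : ∀ e ∈ T.G.edgeSet, ∀ e' ∈ T'.G.edgeSet, T.SameSplit T' e e' → T.w e = T'.w e') :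
    T.Isom T' := by
  choose φ hφ using T.exists_corresponds T' hn hT
  choose ψ hψ using T'.exists_corresponds T hn hT'
  have hadj : ∀ a b, T.G.Adj a b ↔ T'.G.Adj (φ a) (φ b) := fun a b =>
    ⟨(hφ a).adj hn hT' hs hs' (hφ b), (hφ a).symm.adj hn hT hs' hs (hφ b).symm⟩
  refine ⟨⟨φ, ψ, fun v => ?_, fun v => ?_⟩, hadj, fun i => ?_, fun a b => ?_⟩
  · exact Corresponds.unique hn hs (hψ (φ v)) (hφ v).symm rfl
  · exact Corresponds.unique hn hs' (hφ (ψ v)) (hψ v).symm rfl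
  · refine Corresponds.unique hn hs' (hφ (T.leaf i)) (v' := T'.leaf i) (fun e e' he j => ?_) rfl
    exact he j i
  · change T.w s(a, b) = T'.w s(φ a, φ b)
    by_cases h : T.G.Adj a b
    · obtain ⟨e', he', hse⟩ := hs s(a, b) h
      have h' := (hadj a b).mp h
      have h1 := ((hφ a).separates_iff hn (hφ b) hse).mp ((Separates.adj_iff T.isTree h).mpr rfl)
      rw [Separates.adj_iff T'.isTree h'] at h1
      exact hw _ h _ h' (h1 ▸ hse)
    · rw [T.wSupport _ (by simpa using h),
        T'.wSupport _ (by simpa using fun h' => h ((hadj a b).mpr h'))]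

variable {T : WTree n}

theorem LSep.symm {e : Sym2 T.V} {i j : Fin n} (h : T.LSep e i j) : T.LSep e j i :=
  Separates.symm h

theorem LSep.iff_not_iff {e : Sym2 T.V} (x : Fin n) {i j : Fin n} :
    T.LSep e i j ↔ ¬ (T.LSep e x i ↔ T.LSep e x j) :=
  Separates.iff_not_iff T.connected

theorem LSep.compatible {e f : Sym2 T.V} {x y z w : Fin n} (hxy : T.LSep e x y)
    (hfxy : ¬ T.LSep f x y) (hxz : T.LSep f x z) (hfzw : ¬ T.LSep f z w)
    (hzw : T.LSep e z w) : False :=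
  Separates.compatible T.isTree hxy hfxy hxz hfzw hzw

open Classical in
theorem splits_insert_insert (e : Sym2 T.V) {X : Finset (Fin n)} {x : Fin n} (hx : x ∈ X)
    (i j : Fin n) : T.splits e (insert i (insert j X)) =
      if (∃ y ∈ X, T.LSep e x y) ∨ T.LSep e x i ∨ T.LSep e x j then 1 else 0 := by
  rw [splits]
  congr 1
  simp only [Finset.mem_insert, eq_iff_iff]
  constructor
  · rintro ⟨p, hp, q, hq, h⟩
    rw [LSep.iff_not_iff x] at h
    have key : ∀ p, (p = i ∨ p = j ∨ p ∈ X) → T.LSep e x p →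
        (∃ y ∈ X, T.LSep e x y) ∨ T.LSep e x i ∨ T.LSep e x j := by
      rintro p (rfl | rfl | hp) h
      · exact .inr (.inl h)
      · exact .inr (.inr h)
      · exact .inl ⟨p, hp, h⟩
    by_cases h1 : T.LSep e x p
    · exact key p hp h1
    · exact key q hq (by tauto)
  · rintro (⟨y, hy, h⟩ | h | h)
    · exact ⟨x, .inr (.inr hx), y, .inr (.inr hy), h⟩
    · exact ⟨x, .inr (.inr hx), i, .inl rfl, h⟩
    · exact ⟨x, .inr (.inr hx), j, .inr (.inl rfl), h⟩

/-- The contribution of `e` to the four-point combination of the leaves `i, j, l, m`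
relative to the set `X`. -/
noncomputable def quartet (T : WTree n) (X : Finset (Fin n)) (i j l m : Fin n) (e : Sym2 T.V) : ℝ :=
  T.splits e (insert i (insert j X)) + T.splits e (insert l (insert m X))
    - T.splits e (insert i (insert l X)) - T.splits e (insert j (insert m X))

theorem quartet_ne_zero {e : Sym2 T.V} {X : Finset (Fin n)} {x : Fin n} (hx : x ∈ X)
    {i j l m : Fin n} (h : T.quartet X i j l m e ≠ 0) :
    (∀ y ∈ X, ¬ T.LSep e x y) ∧ T.LSep e i m ∧ T.LSep e j l := by
  classical
  simp only [quartet, splits_insert_insert e hx] at h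
  rw [LSep.iff_not_iff x (i := i), LSep.iff_not_iff x (i := j)]
  by_cases h0 : ∃ y ∈ X, T.LSep e x y
  · simp [h0] at h
  · refine ⟨fun y hy hs => h0 ⟨y, hy, hs⟩, ?_⟩
    simp only [h0, false_or] at h
    by_cases hi : T.LSep e x i <;> by_cases hj : T.LSep e x j <;>
      by_cases hl : T.LSep e x l <;> by_cases hm : T.LSep e x m <;>
      simp [hi, hj, hl, hm] at h ⊢

theorem quartet_eq {e : Sym2 T.V} {X : Finset (Fin n)} {x : Fin n} (hx : x ∈ X)
    {i j l m : Fin n} (hX : ∀ y ∈ X, ¬ T.LSep e x y) (hij : ¬ T.LSep e i j)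
    (him : T.LSep e i m) (hjl : T.LSep e j l) : T.quartet X i j l m e = -1 := by
  classical
  have h0 : ¬ ∃ y ∈ X, T.LSep e x y := by push Not; exact hX
  simp only [quartet, splits_insert_insert e hx]
  rw [LSep.iff_not_iff x] at hij him hjl
  simp only [h0, false_or]
  by_cases hi : T.LSep e x i <;> by_cases hj : T.LSep e x j <;>
    by_cases hl : T.LSep e x l <;> by_cases hm : T.LSep e x m <;>
    simp [hi, hj, hl, hm] at hij him hjl ⊢

/-- The `I`-weight of the tree with respect to an arbitrary weight function on the edges. -/
noncomputable def weightOn (T : WTree n) (u : Sym2 T.V → ℝ) (I : Finset (Fin n)) : ℝ :=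
  ∑ e ∈ T.edges, u e * T.splits e I

theorem sum_quartet (u : Sym2 T.V → ℝ) (X : Finset (Fin n)) (i j l m : Fin n) :
    ∑ e ∈ T.edges, u e * T.quartet X i j l m e =
      T.weightOn u (insert i (insert j X)) + T.weightOn u (insert l (insert m X))
        - T.weightOn u (insert i (insert l X)) - T.weightOn u (insert j (insert m X)) := by
  simp only [weightOn, ← Finset.sum_add_distrib, ← Finset.sum_sub_distrib]
  refine Finset.sum_congr rfl fun e _ => ?_
  rw [quartet]
  ring

theorem exists_edge_of_quartet {u : Sym2 T.V → ℝ} {X : Finset (Fin n)} {x : Fin n} (hx : x ∈ X)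
    {i j l m : Fin n} (h1 : ∑ e ∈ T.edges, u e * T.quartet X i j l m e ≠ 0)
    (h2 : ∑ e ∈ T.edges, u e * T.quartet X i j m l e ≠ 0) :
    ∃ e, u e ≠ 0 ∧ (∀ y ∈ X, ¬ T.LSep e x y) ∧ T.LSep e i l ∧ ¬ T.LSep e i j ∧
      ¬ T.LSep e l m := by
  obtain ⟨e, -, he⟩ := Finset.exists_ne_zero_of_sum_ne_zero h1
  obtain ⟨f, -, hf⟩ := Finset.exists_ne_zero_of_sum_ne_zero h2
  obtain ⟨heX, him, hjl⟩ := quartet_ne_zero hx (right_ne_zero_of_mul he)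
  obtain ⟨hfX, hil, hjm⟩ := quartet_ne_zero hx (right_ne_zero_of_mul hf)
  rw [LSep.iff_not_iff i] at hjl hjm
  by_cases heij : T.LSep e i j
  · by_cases hfij : T.LSep f i j
    · refine (LSep.compatible him (f := f) (w := l) ?_ hfij ?_ ?_).elim
      · tauto
      · rw [LSep.iff_not_iff i]; tauto
      · rw [LSep.iff_not_iff i]; tauto
    · exact ⟨f, left_ne_zero_of_mul hf, hfX, hil, hfij, by rw [LSep.iff_not_iff i]; tauto⟩
  · exact ⟨e, left_ne_zero_of_mul he, heX, by tauto, heij, by rw [LSep.iff_not_iff i]; tauto⟩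

theorem Across.eq_of_self {v : T.V} {i : Fin n} (h : T.Across v i i) : T.leaf i = v := by
  by_contra hne
  obtain ⟨x, -, hx⟩ := Separates.exists_of_ne T.isTree hne
  exact h _ hx hx

theorem Across.symm {v : T.V} {i j : Fin n} (h : T.Across v i j) : T.Across v j i :=
  fun e he he' => h e he' he

theorem Across.or {v : T.V} {i j : Fin n} (h : T.Across v i j) (x : Fin n) :
    T.Across v i x ∨ T.Across v j x := by
  by_contra! hc
  simp only [Across] at hc
  push Not at hc
  obtain ⟨⟨e, hei, hex⟩, ⟨f, hfj, hfx⟩⟩ := hc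
  have hc := T.connected
  have hej := h e hei
  have hfi : ¬ T.G.Separates f (T.leaf i) v := fun h' => h f h' hfj
  have h1 : ¬ T.G.Separates e (T.leaf i) (T.leaf x) := Separates.not_of_of hc hei hex.symm
  have h2 : T.G.Separates f (T.leaf i) (T.leaf x) := by
    rw [Separates.congr_left hfi]; exact hfx.symm
  have h3 : T.G.Separates f v (T.leaf j) := hfj.symm
  exact Separates.compatible T.isTree h2 h1 hei (fun h' => hej h'.symm) h3

theorem exists_across (hn : 2 ≤ n) (hT : T.Essential) {a b : T.V} (hab : T.G.Adj a b)
    (ha : a ∉ Set.range T.leaf) : ∃ i j, T.Across a i j ∧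
      ¬ T.G.Separates s(a, b) (T.leaf i) a ∧ ¬ T.G.Separates s(a, b) (T.leaf j) a := by
  have h3 := T.three_le_deg hn hT ha
  have h2 : 1 < (T.G.neighborSet a \ {b}).ncard := by
    rw [Set.ncard_sdiff_singleton_of_mem (show b ∈ T.G.neighborSet a from hab)]
    rw [deg] at h3
    omega
  obtain ⟨x, ⟨hx, hxb⟩, y, ⟨hy, hyb⟩, hxy⟩ := (Set.one_lt_ncard (Set.toFinite _)).mp h2
  obtain ⟨i, hi⟩ := T.exists_leaf_of_adj hx
  obtain ⟨j, hj⟩ := T.exists_leaf_of_adj hy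
  have hba : T.G.Separates s(a, b) b a := ((Separates.adj_iff T.isTree hab).mpr rfl).symm
  refine ⟨i, j, fun e => Separates.not_of_branches T.isTree hx hy hxy hi hj,
    fun h => ?_, fun h => ?_⟩
  · exact Separates.not_of_branches T.isTree hx hab hxb hi hba h hba
  · exact Separates.not_of_branches T.isTree hy hab hyb hj hba h hba

theorem eq_of_across {a b : T.V} (hab : T.G.Adj a b) {i j l m : Fin n} (hij : T.Across a i j)
    (hlm : T.Across b l m) (him' : T.LSep s(a, b) i m) (hjl' : T.LSep s(a, b) j l)
    (hij' : ¬ T.LSep s(a, b) i j)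
    {e : Sym2 T.V} (him : T.LSep e i m) (hjl : T.LSep e j l) : e = s(a, b) := by
  by_contra hne
  have hc := T.connected
  have hab' : ¬ T.G.Separates e a b := fun h => hne ((Separates.adj_iff T.isTree hab).mp h)
  have h1 := hij e
  have h2 := hlm e
  rw [← Separates.congr_right hab', ← Separates.congr_right hab'] at h2
  have key : ∀ p q, T.LSep s(a, b) p q → T.G.Separates e (T.leaf p) a →
      ¬ T.G.Separates e (T.leaf q) a := fun p q hpq hp hq =>
    Separates.not_of_side hc hp hq hpq
  have him'' := (Separates.iff_not_iff hc (x := a)).mp him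
  have hjl'' := (Separates.iff_not_iff hc (x := a)).mp hjl
  rw [Separates.comm, Separates.comm (x := a)] at him'' hjl''
  have hil := key i l (Separates.of_left hjl' fun h => hij' h.symm)
  have hjm := key j m (Separates.of_left him' hij')
  clear key hij hlm him hjl him' hjl' hij'
  tauto

theorem sum_quartet_eq {a b : T.V} (hab : T.G.Adj a b) {i j l m : Fin n} (hij : T.Across a i j)
    (hlm : T.Across b l m) (him' : T.LSep s(a, b) i m) (hjl' : T.LSep s(a, b) j l)
    (hij' : ¬ T.LSep s(a, b) i j) {X : Finset (Fin n)} {x : Fin n} (hx : x ∈ X)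
    (hX : ∀ y ∈ X, ¬ T.LSep s(a, b) x y) (u : Sym2 T.V → ℝ) :
    ∑ e ∈ T.edges, u e * T.quartet X i j l m e = - u s(a, b) := by
  rw [Finset.sum_eq_single s(a, b)]
  · rw [quartet_eq hx hX hij' him' hjl']
    ring
  · intro e _ hne
    by_contra h
    obtain ⟨-, h1, h2⟩ := quartet_ne_zero hx (right_ne_zero_of_mul h)
    exact hne (eq_of_across hab hij hlm him' hjl' hij' h1 h2)
  · intro h
    exact absurd (T.mem_edges.mpr hab) h

/-- Some edge of `T` separates each leaf in `A` from each leaf in `B`. -/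
def SeparatesSets (T : WTree n) (A B : Finset (Fin n)) : Prop :=
  ∃ e, ∀ x ∈ A, ∀ z ∈ B, T.LSep e x z

theorem SeparatesSets.symm {A B : Finset (Fin n)} (h : T.SeparatesSets A B) :
    T.SeparatesSets B A := by
  obtain ⟨e, he⟩ := h
  exact ⟨e, fun x hx z hz => (he z hz x hx).symm⟩

theorem not_lSep_of_lSep {e : Sym2 T.V} {x y z : Fin n} (h : T.LSep e x z) (h' : T.LSep e y z) :
    ¬ T.LSep e x y :=
  Separates.not_of_of T.connected h h'.symm

theorem LSep.of_left {e : Sym2 T.V} {x y z : Fin n} (h : T.LSep e x z) (hxy : ¬ T.LSep e x y) :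
    T.LSep e y z :=
  Separates.of_left h hxy

theorem SeparatesSets.pair {A : Finset (Fin n)} (hA : A.Nonempty) {l m p : Fin n}
    (hl : T.SeparatesSets A {l, p}) (hm : T.SeparatesSets A {m, p}) :
    T.SeparatesSets A {l, m} := by
  obtain ⟨e, he⟩ := hl
  obtain ⟨f, hf⟩ := hm
  obtain ⟨a, ha⟩ := hA
  simp only [Finset.mem_insert, Finset.mem_singleton, forall_eq_or_imp, forall_eq] at he hf
  have extend : ∀ {g : Sym2 T.V} {p q : Fin n}, (∀ x ∈ A, T.LSep g x p) → T.LSep g a q →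
      ∀ x ∈ A, T.LSep g x q := fun h hq x hx =>
    hq.of_left (not_lSep_of_lSep (h a ha) (h x hx))
  by_cases h1 : T.LSep e a m
  · refine ⟨e, fun x hx => ?_⟩
    simpa using ⟨(he x hx).1, extend (fun x hx => (he x hx).1) h1 x hx⟩
  by_cases h2 : T.LSep f a l
  · refine ⟨f, fun x hx => ?_⟩
    simpa using ⟨extend (fun x hx => (hf x hx).1) h2 x hx, (hf x hx).1⟩
  refine (LSep.compatible (hf a ha).1 h1 (he a ha).1
    (not_lSep_of_lSep (he a ha).1.symm (he a ha).2.symm) ?_).elim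
  exact (hf a ha).2.of_left h2

theorem separatesSets_of_pairs {A : Finset (Fin n)} (hA : A.Nonempty) (B : Finset (Fin n))
    (h : ∀ l ∈ B, ∀ m ∈ B, T.SeparatesSets A {l, m}) : T.SeparatesSets A B := by
  classical
  obtain ⟨a, ha⟩ := hA
  induction B using Finset.induction_on with
  | empty => exact ⟨s(T.leaf a, T.leaf a), by simp⟩
  | insert m B _ ih =>
    rcases B.eq_empty_or_nonempty with rfl | ⟨l, hl⟩
    · simpa using h m (by simp) m (by simp)
    obtain ⟨e, he⟩ := ih fun l hl m hm =>
      h l (Finset.mem_insert_of_mem hl) m (Finset.mem_insert_of_mem hm)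
    by_cases h1 : T.LSep e a m
    · refine ⟨e, fun x hx z hz => ?_⟩
      rcases Finset.mem_insert.mp hz with rfl | hz
      · exact h1.of_left (not_lSep_of_lSep (he a ha l hl) (he x hx l hl))
      · exact he x hx z hz
    · obtain ⟨f, hf⟩ := h l (Finset.mem_insert_of_mem hl) m (Finset.mem_insert_self _ _)
      simp only [Finset.mem_insert, Finset.mem_singleton, forall_eq_or_imp, forall_eq] at hf
      refine ⟨f, fun x hx z hz => ?_⟩
      rcases Finset.mem_insert.mp hz with rfl | hz
      · exact (hf x hx).2
      by_contra hfz
      have hea := he x hx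
      have h2 : ¬ T.LSep e x m := fun h => h1
        (h.of_left (not_lSep_of_lSep (he x hx l hl) (he a ha l hl)))
      exact LSep.compatible (hf x hx).2 h2 (hea z hz) (not_lSep_of_lSep (hea z hz).symm
        (hea l hl).symm) ((hf x hx).1.of_left hfz)

section Recovery

variable {T' : WTree n} {k : ℕ} {u : Sym2 T.V → ℝ} {u' : Sym2 T'.V → ℝ} {a b : T.V}

theorem exists_quartet_edge (hk : 3 ≤ k)
    (hD : ∀ I : Finset (Fin n), I.card = k → T.weightOn u I = T'.weightOn u' I)
    (hab : T.G.Adj a b) (hu : u s(a, b) ≠ 0) {Y : Finset (Fin n)} (hY : Y.card = k)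
    (hYs : ∀ y ∈ Y, ∀ y' ∈ Y, ¬ T.LSep s(a, b) y y') {i j l m : Fin n} (hi : i ∈ Y) (hj : j ∈ Y)
    (hne : i ≠ j) (hij : T.Across a i j) (hlm : T.Across b l m) (hlm' : l ≠ m)
    (hil : T.LSep s(a, b) i l) (him : T.LSep s(a, b) i m) :
    ∃ e, u' e ≠ 0 ∧ (∀ y ∈ Y, y ≠ i → y ≠ j → ∀ y' ∈ Y, y' ≠ i → y' ≠ j → ¬ T'.LSep e y y') ∧
      T'.LSep e i l ∧ ¬ T'.LSep e i j ∧ ¬ T'.LSep e l m := by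
  classical
  set X := (Y.erase i).erase j with hX
  have hXY : insert i (insert j X) = Y := by
    rw [hX, Finset.insert_erase (Finset.mem_erase.mpr ⟨hne.symm, hj⟩), Finset.insert_erase hi]
  have hXcard : X.card + 2 = k := by
    rw [hX, Finset.card_erase_of_mem (Finset.mem_erase.mpr ⟨hne.symm, hj⟩),
      Finset.card_erase_of_mem hi]
    omega
  obtain ⟨x, hx⟩ : X.Nonempty := Finset.card_pos.mp (by omega)
  have hXsub : ∀ y ∈ X, y ∈ Y := fun y hy => Finset.mem_of_mem_erase (Finset.mem_of_mem_erase hy)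
  have hmem : ∀ y, y ∈ X ↔ y ∈ Y ∧ y ≠ i ∧ y ≠ j := by
    intro y; simp only [hX, Finset.mem_erase]; tauto
  have hfar : ∀ z, T.LSep s(a, b) i z → z ∉ Y := fun z hz hzY => hYs i hi z hzY hz
  have hlY := hfar l hil
  have hmY := hfar m him
  have hcard : ∀ p q, p ∉ X → q ∉ X → p ≠ q → (insert p (insert q X)).card = k := by
    intro p q hp hq hpq
    rw [Finset.card_insert_of_notMem (by simp [hpq, hp]), Finset.card_insert_of_notMem hq]
    omega
  have hiX : i ∉ X := by simp [hX]
  have hjX : j ∉ X := by simp [hX]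
  have hlX : l ∉ X := fun h => hlY (hXsub l h)
  have hmX : m ∉ X := fun h => hmY (hXsub m h)
  have hil' : i ≠ l := fun h => hlY (h ▸ hi)
  have him' : i ≠ m := fun h => hmY (h ▸ hi)
  have hjl' : j ≠ l := fun h => hlY (h ▸ hj)
  have hjm' : j ≠ m := fun h => hmY (h ▸ hj)
  have hjl : T.LSep s(a, b) j l := hil.of_left (hYs i hi j hj)
  have hjm : T.LSep s(a, b) j m := him.of_left (hYs i hi j hj)
  have hXs : ∀ y ∈ X, ¬ T.LSep s(a, b) x y := fun y hy => hYs x (hXsub x hx) y (hXsub y hy)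
  have h1 : ∑ e ∈ T'.edges, u' e * T'.quartet X i j l m e ≠ 0 := by
    rw [sum_quartet, ← hD _ (hcard i j hiX hjX hne), ← hD _ (hcard l m hlX hmX hlm'),
      ← hD _ (hcard i l hiX hlX hil'), ← hD _ (hcard j m hjX hmX hjm'), ← sum_quartet,
      sum_quartet_eq hab hij hlm him hjl (hYs i hi j hj) hx hXs]
    exact neg_ne_zero.mpr hu
  have h2 : ∑ e ∈ T'.edges, u' e * T'.quartet X i j m l e ≠ 0 := by
    rw [sum_quartet, ← hD _ (hcard i j hiX hjX hne), ← hD _ (hcard m l hmX hlX hlm'.symm),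
      ← hD _ (hcard i m hiX hmX him'), ← hD _ (hcard j l hjX hlX hjl'), ← sum_quartet,
      sum_quartet_eq hab hij hlm.symm hil hjm (hYs i hi j hj) hx hXs]
    exact neg_ne_zero.mpr hu
  obtain ⟨e, hue, heX, he⟩ := exists_edge_of_quartet hx h1 h2
  refine ⟨e, hue, fun y hy hyi hyj y' hy' hyi' hyj' => ?_, he⟩
  have h1 := heX y ((hmem y).mpr ⟨hy, hyi, hyj⟩)
  have h2 := heX y' ((hmem y').mpr ⟨hy', hyi', hyj'⟩)
  rw [LSep.iff_not_iff x]
  tauto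

theorem separatesSets_of_across (hk : 3 ≤ k)
    (hD : ∀ I : Finset (Fin n), I.card = k → T.weightOn u I = T'.weightOn u' I)
    (hab : T.G.Adj a b) (ha : a ∉ Set.range T.leaf)
    (hu : u s(a, b) ≠ 0) {Y : Finset (Fin n)} (hY : Y.card = k)
    (hYs : ∀ y ∈ Y, ∀ y' ∈ Y, ¬ T.LSep s(a, b) y y') {i j l m : Fin n} (hi : i ∈ Y) (hj : j ∈ Y)
    (hij : T.Across a i j) (hlm : T.Across b l m) (hlm' : l ≠ m)
    (hil : T.LSep s(a, b) i l) (him : T.LSep s(a, b) i m) :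
    T'.SeparatesSets Y {l, m} := by
  have ne_of_across : ∀ {i j}, T.Across a i j → i ≠ j := by
    rintro i _ h rfl
    exact ha ⟨i, h.eq_of_self⟩
  have key : ∀ {i j}, i ∈ Y → j ∈ Y → T.Across a i j →
      ∃ e, (∀ y ∈ Y, y ≠ i → y ≠ j → ∀ y' ∈ Y, y' ≠ i → y' ≠ j → ¬ T'.LSep e y y') ∧
        T'.LSep e i l ∧ ¬ T'.LSep e i j ∧ ¬ T'.LSep e l m := fun {i' j'} hi' hj' h => by
    obtain ⟨e, -, he⟩ := exists_quartet_edge hk hD hab hu hY hYs hi' hj' (ne_of_across h) h hlm hlm'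
      (hil.of_left (hYs i hi i' hi')) (him.of_left (hYs i hi i' hi'))
    exact ⟨e, he⟩
  have finish : ∀ e, (∀ y ∈ Y, T'.LSep e y l) → ¬ T'.LSep e l m → T'.SeparatesSets Y {l, m} := by
    refine fun e h hlm => ⟨e, fun y hy => ?_⟩
    simp only [Finset.mem_insert, Finset.mem_singleton, forall_eq_or_imp, forall_eq]
    exact ⟨h y hy, ((h y hy).symm.of_left hlm).symm⟩
  -- If the remaining leaves of `Y` lie beyond `l, m`, exchange `j` for one of them.
  have step : ∀ {i j x}, i ∈ Y → j ∈ Y → x ∈ Y → x ≠ j → T.Across a i j → T.Across a i x →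
      T'.SeparatesSets Y {l, m} := by
    intro i j x hi hj hx hxj hij hix
    obtain ⟨e, heX, heil, heij, helm⟩ := key hi hj hij
    by_cases hexl : T'.LSep e x l
    · refine finish e (fun y hy => ?_) helm
      by_cases hyi : y = i
      · exact hyi ▸ heil
      by_cases hyj : y = j
      · exact hyj ▸ heil.of_left heij
      · exact hexl.of_left (heX x hx (ne_of_across hix).symm hxj y hy hyi hyj)
    obtain ⟨f, hfX, hfil, hfix, hflm⟩ := key hi hx hix
    by_cases hfjl : T'.LSep f j l
    · refine finish f (fun y hy => ?_) hflm
      by_cases hyi : y = i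
      · exact hyi ▸ hfil
      by_cases hyx : y = x
      · exact hyx ▸ hfil.of_left hfix
      · exact hfjl.of_left (hfX j hj (ne_of_across hij).symm hxj.symm y hy hyi hyx)
    have h1 : T'.LSep f i j := by
      by_contra h
      exact hfjl (hfil.of_left h)
    exact (LSep.compatible h1 heij heil (fun h => hexl h.symm)
      (hfil.of_left hfix).symm).elim
  classical
  obtain ⟨x, hx⟩ : ((Y.erase i).erase j).Nonempty := by
    rw [← Finset.card_pos, Finset.card_erase_of_mem
      (Finset.mem_erase.mpr ⟨(ne_of_across hij).symm, hj⟩), Finset.card_erase_of_mem hi]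
    omega
  simp only [Finset.mem_erase] at hx
  rcases hij.or x with h | h
  · exact step hi hj hx.2.2 hx.1 hij h
  · exact step hj hi hx.2.2 hx.2.1 hij.symm h

theorem exists_sameSplit (hk : 3 ≤ k) (hn : 2 ≤ n) (hT : T.Essential)
    (hD : ∀ I : Finset (Fin n), I.card = k → T.weightOn u I = T'.weightOn u' I)
    (hab : T.G.Adj a b) (ha : a ∉ Set.range T.leaf) (hb : b ∉ Set.range T.leaf)
    (hu : u s(a, b) ≠ 0) (hS : k ≤ (T.sideLeaves s(a, b) a).ncard) :
    ∃ e' ∈ T'.G.edgeSet, T.SameSplit T' s(a, b) e' := by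
  classical
  have hc := T.connected
  set S := (Set.toFinite (T.sideLeaves s(a, b) a)).toFinset with hSdef
  have hSmem : ∀ i, i ∈ S ↔ ¬ T.G.Separates s(a, b) (T.leaf i) a := fun i => by
    rw [hSdef, Set.Finite.mem_toFinset, mem_sideLeaves]
  rw [Set.ncard_eq_toFinset_card _ (Set.toFinite _), ← hSdef] at hS
  have hsep : ∀ i j, T.LSep s(a, b) i j ↔ ¬ (i ∈ S ↔ j ∈ S) := by
    intro i j
    rw [LSep, Separates.iff_not_iff hc (x := a), hSmem, hSmem, Separates.comm (x := a),
      Separates.comm (x := a)]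
    tauto
  have hadj : T.G.Separates s(a, b) a b := (Separates.adj_iff T.isTree hab).mpr rfl
  obtain ⟨i, j, hij, hi, hj⟩ := exists_across hn hT hab ha
  obtain ⟨l, m, hlm, hl, hm⟩ := exists_across hn hT hab.symm hb
  have hlm' : l ≠ m := by rintro rfl; exact hb ⟨l, hlm.eq_of_self⟩
  rw [← hSmem] at hi hj
  rw [Sym2.eq_swap, Separates.right_iff hc hadj, not_not] at hl hm
  have hl : l ∉ S := fun h => (hSmem l).mp h hl
  have hm : m ∉ S := fun h => (hSmem m).mp h hm
  have hpairs : ∀ Y ⊆ S, Y.card = k → (∃ p ∈ Y, ∃ q ∈ Y, T.Across a p q) →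
      T'.SeparatesSets Y Sᶜ := by
    rintro Y hYS hYk ⟨p, hp, q, hq, hpq⟩
    have hYne : Y.Nonempty := ⟨p, hp⟩
    have hdir : ∀ r s, r ∉ S → s ∉ S → T.Across b r s → T'.SeparatesSets Y {r, s} := by
      intro r s hr hs hrs
      refine separatesSets_of_across hk hD hab ha hu hYk (fun y hy y' hy' => ?_) hp hq hpq hrs
        ?_ ?_ ?_
      · rw [hsep]; simp [hYS hy, hYS hy']
      · rintro rfl; exact hb ⟨r, hrs.eq_of_self⟩
      · rw [hsep]; simp [hYS hp, hr]
      · rw [hsep]; simp [hYS hp, hs]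
    refine separatesSets_of_pairs hYne _ fun r hr s hs => ?_
    rw [Finset.mem_compl] at hr hs
    by_cases hrs : T.Across b r s
    · exact hdir r s hr hs hrs
    · obtain ⟨t, ht, htr⟩ : ∃ t, t ∉ S ∧ T.Across b t r := by
        rcases hlm.or r with h | h
        · exact ⟨l, hl, h⟩
        · exact ⟨m, hm, h⟩
      have hts : T.Across b t s := (htr.symm.or s |>.resolve_left hrs)
      exact SeparatesSets.pair hYne (hdir r t hr ht htr.symm) (hdir s t hs ht hts.symm)
  have hSB : T'.SeparatesSets Sᶜ S := by
    refine separatesSets_of_pairs ⟨l, Finset.mem_compl.mpr hl⟩ _ fun y hy y' hy' => ?_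
    obtain ⟨z, hz, hyz⟩ : ∃ z ∈ S, T.Across a y z := by
      rcases hij.or y with h | h
      · exact ⟨i, hi, h.symm⟩
      · exact ⟨j, hj, h.symm⟩
    obtain ⟨Y, hY1, hY2, hY3⟩ := Finset.exists_subsuperset_card_eq (s := {y, y', z}) (t := S)
      (n := k) (by simp [Finset.insert_subset_iff, hy, hy', hz])
      (Finset.card_le_three.trans hk) hS
    simp only [Finset.insert_subset_iff, Finset.singleton_subset_iff] at hY1
    obtain ⟨e, he⟩ := hpairs Y hY2 hY3 ⟨y, hY1.1, z, hY1.2.2, hyz⟩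
    refine SeparatesSets.symm ⟨e, fun x hx w hw => he x ?_ w hw⟩
    rcases Finset.mem_insert.mp hx with rfl | hx
    · exact hY1.1
    · exact Finset.mem_singleton.mp hx ▸ hY1.2.1
  obtain ⟨e, he⟩ := hSB
  have hel := he l (Finset.mem_compl.mpr hl)
  refine ⟨e, T'.mem_edges.mp (hel i hi).mem_edges, fun x y => ?_⟩
  have hmem : ∀ x, x ∈ S ↔ T'.LSep e l x := fun x => by
    refine ⟨fun hx => hel x hx, fun hx => ?_⟩
    by_contra hxS
    exact not_lSep_of_lSep (hel i hi) (he x (Finset.mem_compl.mpr hxS) i hi) hx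
  rw [hsep, hmem, hmem, ← LSep.iff_not_iff]

end Recovery

theorem exists_adj_leaf (T : WTree n) (i : Fin n) : ∃ b, T.G.Adj (T.leaf i) b := by
  obtain ⟨c, hc⟩ := Set.ncard_eq_one.mp ((T.leafSpec (T.leaf i)).mpr ⟨i, rfl⟩)
  exact ⟨c, hc.ge rfl⟩

/-- The pendant edge at the leaf `i`. -/
noncomputable def pend (T : WTree n) (i : Fin n) : Sym2 T.V :=
  s(T.leaf i, (T.exists_adj_leaf i).choose)

theorem pend_mem (T : WTree n) (i : Fin n) : T.pend i ∈ T.G.edgeSet :=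
  (T.exists_adj_leaf i).choose_spec

theorem lSep_pend (T : WTree n) {i p q : Fin n} :
    T.LSep (T.pend i) p q ↔ ¬ (p = i ↔ q = i) := by
  have h : ∀ p, T.LSep (T.pend i) i p ↔ p ≠ i := fun p => by
    constructor
    · rintro h rfl
      exact Separates.irrefl _ _ h
    · intro h
      exact (T.separates_of_leaf (T.pend_mem i) fun h' => h (T.leafInj h')).symm
  rw [LSep.iff_not_iff i, h, h]
  tauto

theorem eq_pend {i : Fin n} {b : T.V} (h : T.G.Adj (T.leaf i) b) : s(T.leaf i, b) = T.pend i := by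
  have h1 := T.separates_of_leaf (T.pend_mem i) h.ne'
  exact ((Separates.adj_iff T.isTree h).mp h1.symm).symm

theorem pend_injective (T : WTree n) (hn : 3 ≤ n) : Function.Injective T.pend := by
  intro i j h
  rcases Sym2.eq_iff.mp h with ⟨h, -⟩ | ⟨h, -⟩
  · exact T.leafInj h
  · have := (T.exists_adj_leaf j).choose_spec
    rw [← h] at this
    exact (T.not_adj_leaf_leaf hn _ _ this).elim

theorem mem_range_pend {a b : T.V} (hab : T.G.Adj a b) :
    s(a, b) ∈ Set.range T.pend ↔ ∃ i, T.leaf i = a ∨ T.leaf i = b := by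
  constructor
  · rintro ⟨i, h⟩
    refine ⟨i, ?_⟩
    have : T.leaf i ∈ s(a, b) := h ▸ Sym2.mem_mk_left _ _
    simpa using this
  · rintro ⟨i, rfl | rfl⟩
    · exact ⟨i, (eq_pend hab).symm⟩
    · exact ⟨i, (eq_pend hab.symm).symm.trans Sym2.eq_swap⟩

theorem splits_pend {i : Fin n} {I : Finset (Fin n)} (hI : 2 ≤ I.card) :
    T.splits (T.pend i) I = if i ∈ I then 1 else 0 := by
  classical
  rw [splits]
  congr 1
  simp only [lSep_pend, eq_iff_iff]
  constructor
  · rintro ⟨p, hp, q, hq, h⟩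
    by_cases hpi : p = i
    · exact hpi ▸ hp
    · have : q = i := by tauto
      exact this ▸ hq
  · intro hi
    obtain ⟨j, hj, hne⟩ := Finset.exists_mem_ne hI i
    exact ⟨i, hi, j, hj, by simp [hne]⟩

/-- Only pendant edges matter if the weights of all other edges vanish. -/
theorem weightOn_of_pend (hn : 3 ≤ n) {u : Sym2 T.V → ℝ}
    (hu : ∀ e ∈ T.edges, e ∉ Set.range T.pend → u e = 0) {I : Finset (Fin n)} (hI : 2 ≤ I.card) :
    T.weightOn u I = ∑ i ∈ I, u (T.pend i) := by
  classical
  have h1 : T.weightOn u I = ∑ e ∈ Finset.univ.image T.pend, u e * T.splits e I := by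
    refine (Finset.sum_subset (fun e he => ?_) fun e he he' => ?_).symm
    · obtain ⟨i, -, rfl⟩ := Finset.mem_image.mp he
      exact T.mem_edges.mpr (T.pend_mem i)
    · rw [hu e he (by simpa using he'), zero_mul]
  rw [h1, Finset.sum_image fun i _ j _ h => T.pend_injective hn h]
  simp [splits_pend hI]

theorem IsPseudostar.cases {k : ℕ} (hT : T.IsPseudostar k) {e : Sym2 T.V} (he : e ∈ T.G.edgeSet) :
    ∃ a b, e = s(a, b) ∧ T.G.Adj a b ∧ k ≤ (T.sideLeaves s(a, b) a).ncard := by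
  induction e with | _ a b
  rcases hT a b he with h | h
  · exact ⟨a, b, rfl, he, h⟩
  · exact ⟨b, a, Sym2.eq_swap, SimpleGraph.Adj.symm he, by rwa [Sym2.eq_swap]⟩

theorem eq_zero_of_weightOn {k : ℕ} (hk : 3 ≤ k) (hn : k < n) (hT : T.Essential)
    (hP : T.IsPseudostar k) {u : Sym2 T.V → ℝ}
    (hu : ∀ I : Finset (Fin n), I.card = k → T.weightOn u I = 0) :
    ∀ e ∈ T.edges, u e = 0 := by
  classical
  have hint : ∀ e ∈ T.edges, e ∉ Set.range T.pend → u e = 0 := by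
    intro e he hpe
    by_contra h0
    obtain ⟨a, b, rfl, hab, hS⟩ := hP.cases (T.mem_edges.mp he)
    rw [mem_range_pend hab] at hpe
    push Not at hpe
    have ha : a ∉ Set.range T.leaf := fun ⟨i, hi⟩ => (hpe i).1 hi
    have hb : b ∉ Set.range T.leaf := fun ⟨i, hi⟩ => (hpe i).2 hi
    have hc := T.connected
    have hadj : T.G.Separates s(a, b) a b := (Separates.adj_iff T.isTree hab).mpr rfl
    obtain ⟨i, j, hij, hi, hj⟩ := exists_across (by omega) hT hab ha
    obtain ⟨l, m, hlm, hl, hm⟩ := exists_across (by omega) hT hab.symm hb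
    rw [Sym2.eq_swap, Separates.right_iff hc hadj, not_not] at hl hm
    rw [Set.ncard_eq_toFinset_card _ (Set.toFinite _)] at hS
    obtain ⟨Y, hY1, hY2, hY3⟩ := Finset.exists_subsuperset_card_eq (s := {i, j}) (n := k)
      (by
        intro x hx
        rw [Set.Finite.mem_toFinset, mem_sideLeaves]
        rcases Finset.mem_insert.mp hx with rfl | hx
        · exact hi
        · exact Finset.mem_singleton.mp hx ▸ hj)
      (Finset.card_le_two.trans (by omega)) hS
    have hYs : ∀ y ∈ Y, ¬ T.G.Separates s(a, b) (T.leaf y) a := fun y hy => by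
      simpa [mem_sideLeaves] using hY2 hy
    simp only [Finset.insert_subset_iff, Finset.singleton_subset_iff] at hY1
    obtain ⟨e, he, -⟩ := exists_quartet_edge (T' := T) (u' := 0) hk
      (fun I hI => by rw [hu I hI]; simp [weightOn]) hab h0 hY3
      (fun y hy y' hy' => (Separates.congr_right (hYs y' hy')).not.mpr (hYs y hy)) hY1.1 hY1.2
      (fun h => ha ⟨i, Across.eq_of_self (h ▸ hij)⟩) hij hlm
      (fun h => hb ⟨l, Across.eq_of_self (h ▸ hlm)⟩)
      ((Separates.congr_left hi).mpr hl.symm) ((Separates.congr_left hi).mpr hm.symm)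
    exact he rfl
  have hp : ∀ I : Finset (Fin n), I.card = k → ∑ i ∈ I, u (T.pend i) = 0 := fun I hI => by
    rw [← weightOn_of_pend (by omega) hint (by omega), hu I hI]
  have hconst : ∀ i j, u (T.pend i) = u (T.pend j) := by
    intro i j
    by_cases hij : i = j
    · rw [hij]
    obtain ⟨J, -, hJ, hJc⟩ := Finset.exists_subsuperset_card_eq (s := ∅)
      (t := (Finset.univ.erase i).erase j) (n := k - 1) (by simp) (by simp) (by
        rw [Finset.card_erase_of_mem (by simp [Ne.symm hij]), Finset.card_erase_of_mem (by simp)]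
        simp
        omega)
    have hi : i ∉ J := fun h => by simpa using hJ h
    have hj : j ∉ J := fun h => by simpa using hJ h
    have h1 := hp (insert i J) (by rw [Finset.card_insert_of_notMem hi]; omega)
    have h2 := hp (insert j J) (by rw [Finset.card_insert_of_notMem hj]; omega)
    rw [Finset.sum_insert hi] at h1
    rw [Finset.sum_insert hj] at h2
    linarith
  intro e he
  by_cases hpe : e ∈ Set.range T.pend
  · obtain ⟨i, rfl⟩ := hpe
    obtain ⟨I, -, hI⟩ := Finset.exists_subset_card_eq (s := (Finset.univ : Finset (Fin n)))
      (n := k) (by simpa using hn.le)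
    have h := hp I hI
    rw [Finset.sum_congr rfl fun j _ => hconst j i, Finset.sum_const, hI, smul_eq_zero] at h
    exact h.resolve_left (by omega)
  · exact hint e he hpe

theorem D_eq_weightOn (T : WTree n) (I : Finset (Fin n)) : T.D I = T.weightOn T.w I :=
  T.D_eq_sum I

/-- Every edge which is not pendant has nonzero weight. -/
def NonpendantNonzero (T : WTree n) : Prop :=
  ∀ a b, T.G.Adj a b → a ∉ Set.range T.leaf → b ∉ Set.range T.leaf → T.w s(a, b) ≠ 0

theorem splitsIn_of_isPseudostar {k : ℕ} (hk : 3 ≤ k) (hn : 2 ≤ n) (hT : T.Essential)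
    (hP : T.IsPseudostar k) (hw : T.NonpendantNonzero) {T' : WTree n}
    (hD : ∀ I : Finset (Fin n), I.card = k → T.D I = T'.D I) : T.SplitsIn T' := by
  intro e he
  obtain ⟨a, b, rfl, hab, hS⟩ := hP.cases he
  by_cases hp : s(a, b) ∈ Set.range T.pend
  · obtain ⟨i, hi⟩ := hp
    refine ⟨T'.pend i, T'.pend_mem i, fun p q => ?_⟩
    rw [← hi, lSep_pend, lSep_pend]
  · simp only [mem_range_pend hab, not_exists, not_or] at hp
    have ha : a ∉ Set.range T.leaf := fun ⟨i, hi⟩ => (hp i).1 hi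
    have hb : b ∉ Set.range T.leaf := fun ⟨i, hi⟩ => (hp i).2 hi
    exact exists_sameSplit hk hn hT (u := T.w) (u' := T'.w)
      (fun I hI => by rw [← D_eq_weightOn, ← D_eq_weightOn, hD I hI]) hab ha hb
      (hw a b hab ha hb) hS

theorem SameSplit.splits_eq {T' : WTree n} {e : Sym2 T.V} {e' : Sym2 T'.V}
    (h : T.SameSplit T' e e') (I : Finset (Fin n)) : T.splits e I = T'.splits e' I := by
  classical
  rw [splits, splits]
  congr 1
  simp only [h _ _]

theorem SameSplit.trans {T' T'' : WTree n} {e : Sym2 T.V} {e' : Sym2 T'.V} {e'' : Sym2 T''.V}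
    (h : T.SameSplit T' e e') (hf : T'.SameSplit T'' e' e'') : T.SameSplit T'' e e'' :=
  fun i j => (h i j).trans (hf i j)

/-- An essential pseudostar without zero internal edges is determined by its `k`-weights. -/
theorem isom_of_isPseudostar {k : ℕ} (hk : 3 ≤ k) (hn : k < n) {T' : WTree n}
    (hT : T.Essential) (hP : T.IsPseudostar k) (hw : T.NonpendantNonzero)
    (hT' : T'.Essential) (hP' : T'.IsPseudostar k) (hw' : T'.NonpendantNonzero)
    (hD : ∀ I : Finset (Fin n), I.card = k → T.D I = T'.D I) : T.Isom T' := by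
  have hn2 : 2 ≤ n := by omega
  have hs := splitsIn_of_isPseudostar hk hn2 hT hP hw hD
  have hs' := splitsIn_of_isPseudostar hk hn2 hT' hP' hw' fun I hI => (hD I hI).symm
  refine isom_of_splitsIn hn2 hT hT' hs hs' ?_
  have : Nonempty (Sym2 T.V) := ⟨T.pend ⟨0, by omega⟩⟩
  have : Nonempty (Sym2 T'.V) := ⟨T'.pend ⟨0, by omega⟩⟩
  choose! ψ hψ hψs using hs
  choose! χ hχ hχs using hs'
  have hψeq : ∀ e ∈ T.G.edgeSet, ∀ e', T.SameSplit T' e e' → ψ e = e' := fun e he e' h =>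
    SameSplit.eq hn2 hT' (hψ e he) ((hψs e he).symm.trans h)
  have hχψ : ∀ e' ∈ T'.G.edgeSet, ψ (χ e') = e' := fun e' he' =>
    hψeq _ (hχ e' he') e' (hχs e' he').symm
  have key := eq_zero_of_weightOn hk hn hT hP (u := fun e => T.w e - T'.w (ψ e)) ?_
  · intro e he e' _ h
    rw [← hψeq e he e' h, ← sub_eq_zero]
    exact key e (T.mem_edges.mpr he)
  · intro I hI
    have h1 : T.weightOn (fun e => T'.w (ψ e)) I = T'.weightOn T'.w I := by
      refine Finset.sum_nbij ψ (fun e he => ?_) (fun e he f hf h => ?_) (fun e' he' => ?_)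
        fun e he => ?_
      · exact T'.mem_edges.mpr (hψ e (T.mem_edges.mp he))
      · have he := T.mem_edges.mp he
        have hf := T.mem_edges.mp hf
        exact SameSplit.eq hn2 hT he ((hψs e he).trans (h ▸ (hψs f hf).symm))
      · have he' := T'.mem_edges.mp he'
        exact ⟨χ e', T.mem_edges.mpr (hχ e' he'), hχψ e' he'⟩
      · rw [(hψs e (T.mem_edges.mp he)).splits_eq]
    have h2 : T.weightOn (fun e => T.w e - T'.w (ψ e)) I =
        T.weightOn T.w I - T.weightOn (fun e => T'.w (ψ e)) I := by
      simp only [weightOn, ← Finset.sum_sub_distrib, sub_mul]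
    rw [h2, h1, ← D_eq_weightOn, ← D_eq_weightOn, hD I hI, sub_self]

/-- `T'` is the contraction of `T` along the edge `s(a, b)`, with weights given by `u`. -/
structure IsContraction (T T' : WTree n) (a b : T.V) (u : Sym2 T.V → ℝ) (φ : T.V → T'.V) :
    Prop where
  graph : T.G.IsContraction T'.G a b φ
  leaf : ∀ i, φ (T.leaf i) = T'.leaf i
  weight : ∀ x y, T.G.Adj x y → s(x, y) ≠ s(a, b) → T'.w s(φ x, φ y) = u s(x, y)

theorem exists_isContraction (hn : 2 ≤ n) (hT : T.Essential) {a b : T.V} (hab : T.G.Adj a b)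
    (ha : a ∉ Set.range T.leaf) (hb : b ∉ Set.range T.leaf) (u : Sym2 T.V → ℝ) :
    ∃ (T' : WTree n) (φ : T.V → T'.V), T.IsContraction T' a b u φ ∧ T'.Essential := by
  classical
  obtain ⟨V', G', φ, h⟩ := T.G.exists_isContraction hab.ne
  have : Finite V' := Finite.of_surjective φ h.surjective
  have hmerged : 2 < (G'.neighborSet (φ a)).ncard := by
    have h1 := T.three_le_deg hn hT ha
    have h2 := T.three_le_deg hn hT hb
    rw [deg] at h1 h2
    exact h.two_lt_ncard_neighborSet T.isTree hab (by omega) (by omega)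
  have hcases : ∀ x, φ x = φ a ∨ x ≠ a ∧ x ≠ b := fun x => by
    by_cases hxa : x = a
    · exact .inl (by rw [hxa])
    by_cases hxb : x = b
    · exact .inl (by rw [hxb, h.map_eq])
    exact .inr ⟨hxa, hxb⟩
  have hleaf : ∀ x i, φ x = φ (T.leaf i) → x = T.leaf i := fun x i hx => by
    rcases h.fiber _ _ hx with h | h
    · exact h
    · rcases Sym2.eq_iff.mp h with h | h
      · exact (hb ⟨i, h.2⟩).elim
      · exact (ha ⟨i, h.2⟩).elim
  have hinj := h.injOn_edges T.isTree hab
  let w' : Sym2 V' → ℝ := fun e' => ∑ e ∈ T.edges with e ≠ s(a, b) ∧ Sym2.map φ e = e', u e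
  refine ⟨{ V := V', fintypeV := Fintype.ofFinite V', G := G', isTree := h.isTree T.isTree hab,
            leaf := φ ∘ T.leaf, leafInj := fun i j hij => T.leafInj (hleaf _ _ hij),
            leafSpec := fun v => ?_, w := w', wSupport := fun e' he' => ?_ }, φ,
            ⟨h, fun _ => rfl, fun x y hxy hne => ?_⟩, fun v => ?_⟩
  · obtain ⟨x, rfl⟩ := h.surjective v
    rcases hcases x with hx | ⟨hxa, hxb⟩
    · rw [hx]
      refine ⟨fun h1 => by omega, fun ⟨i, hi⟩ => (ha ⟨i, (hleaf a i hi.symm).symm⟩).elim⟩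
    · rw [h.ncard_neighborSet T.isTree hab hxa hxb, T.leafSpec]
      exact ⟨fun ⟨i, hi⟩ => ⟨i, congrArg φ hi⟩, fun ⟨i, hi⟩ => ⟨i, (hleaf x i hi.symm).symm⟩⟩
  · refine Finset.sum_eq_zero fun e he => ?_
    simp only [Finset.mem_filter, mem_edges] at he
    exact (he' (he.2.2 ▸ h.map_mem_edgeSet he.1 he.2.1)).elim
  · change ∑ e ∈ T.edges with _, u e = _
    rw [Finset.sum_eq_single s(x, y)]
    · intro e he hexy
      simp only [Finset.mem_filter, mem_edges] at he
      exact (hexy (hinj ⟨he.1, he.2.1⟩ ⟨hxy, hne⟩ he.2.2)).elim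
    · intro hmem
      exact (hmem (Finset.mem_filter.mpr ⟨T.mem_edges.mpr hxy, hne, rfl⟩)).elim
  · obtain ⟨x, rfl⟩ := h.surjective v
    change (G'.neighborSet (φ x)).ncard ≠ 2
    rcases hcases x with hx | ⟨hxa, hxb⟩
    · rw [hx]
      omega
    · rw [h.ncard_neighborSet T.isTree hab hxa hxb]
      exact hT x

/-- The weights after the `k`-IO operation on `s(a, b)`. -/
noncomputable def ioWeight (T : WTree n) (k : ℕ) (a b : T.V) (e : Sym2 T.V) : ℝ :=
  open Classical in T.w e + if e ∈ Set.range T.pend then T.w s(a, b) / k else 0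

namespace IsContraction

variable {T' : WTree n} {a b : T.V} {u : Sym2 T.V → ℝ} {φ : T.V → T'.V}

theorem card_lt (h : T.IsContraction T' a b u φ) (hab : T.G.Adj a b) :
    Nat.card T'.V < Nat.card T.V := by
  rw [Nat.card_eq_fintype_card, Nat.card_eq_fintype_card]
  exact Fintype.card_lt_of_surjective_not_injective φ h.graph.surjective fun hinj =>
    hab.ne (hinj h.graph.map_eq)

theorem D_add (h : T.IsContraction T' a b u φ) (hab : T.G.Adj a b) (I : Finset (Fin n)) :
    T'.D I + u s(a, b) * T.splits s(a, b) I = T.weightOn u I := by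
  classical
  rw [weightOn, ← Finset.sum_erase_add _ _ ((T.mem_edges (e := s(a, b))).mpr hab),
    D_eq_weightOn, weightOn]
  congr 1
  refine (Finset.sum_nbij (Sym2.map φ) (fun e he => ?_) (fun e he f hf hef => ?_)
    (fun e' he' => ?_) fun e he => ?_).symm
  · simp only [Finset.mem_erase, mem_edges] at he
    exact T'.mem_edges.mpr (h.graph.map_mem_edgeSet he.2 he.1)
  · simp only [Finset.coe_erase, Set.mem_sdiff, Finset.mem_coe, mem_edges] at he hf
    exact h.graph.injOn_edges T.isTree hab he hf hef
  · obtain ⟨e, he, hne, rfl⟩ := h.graph.exists_map_eq (T'.mem_edges.mp he')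
    exact ⟨e, by simpa using ⟨he, hne⟩, rfl⟩
  · simp only [Finset.mem_erase, mem_edges] at he
    have hs : T.SameSplit T' e (Sym2.map φ e) := fun i j => by
      rw [LSep, LSep, ← h.leaf, ← h.leaf, h.graph.separates_iff T.isTree hab he.2 he.1]
    rw [hs.splits_eq]
    congr 1
    induction e with | _ x y
    exact (h.weight x y he.2 he.1).symm

theorem insertZeroStep (h : T.IsContraction T' a b T.w φ) (hn : 3 ≤ n) (hT : T.Essential)
    (hab : T.G.Adj a b) (ha : a ∉ Set.range T.leaf) (hb : b ∉ Set.range T.leaf)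
    (hw : T.w s(a, b) = 0) : T'.InsertZeroStep T :=
  ⟨a, b, hab, by rw [T.isTwigEdge_iff hn hT hab]; tauto, hw, φ, h.graph.surjective,
    h.graph.map_eq, h.graph.fiber, h.leaf, h.graph.adj_iff, h.weight⟩

theorem oiStep {k : ℕ} (h : T.IsContraction T' a b (T.ioWeight k a b) φ) (hab : T.G.Adj a b)
    (hA : (T.sideLeaves s(a, b) a).ncard < k) (hB : (T.sideLeaves s(a, b) b).ncard < k) :
    T'.OIStep k T := by
  refine ⟨a, b, hab, hA, hB, φ, h.graph.surjective, h.graph.map_eq, h.graph.fiber, h.leaf,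
    h.graph.adj_iff, fun x y hxy hne => ⟨fun hl => ?_, fun hl => ?_⟩⟩
  · rw [h.weight x y hxy hne, ioWeight, if_pos ((mem_range_pend hxy).mpr hl)]
  · rw [h.weight x y hxy hne, ioWeight, if_neg ((mem_range_pend hxy).not.mpr hl), add_zero]

theorem D_eq_of_weight_eq_zero (h : T.IsContraction T' a b T.w φ) (hab : T.G.Adj a b)
    (hw : T.w s(a, b) = 0) (I : Finset (Fin n)) : T'.D I = T.D I := by
  rw [D_eq_weightOn T, ← h.D_add hab, hw, zero_mul, add_zero]

theorem D_eq_of_ncard_lt {k : ℕ} (h : T.IsContraction T' a b (T.ioWeight k a b) φ) (hn : 3 ≤ n)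
    (hk : 2 ≤ k) (hab : T.G.Adj a b) (ha : a ∉ Set.range T.leaf) (hb : b ∉ Set.range T.leaf)
    (hA : (T.sideLeaves s(a, b) a).ncard < k) (hB : (T.sideLeaves s(a, b) b).ncard < k)
    {I : Finset (Fin n)} (hI : I.card = k) : T'.D I = T.D I := by
  classical
  have hnp : s(a, b) ∉ Set.range T.pend := by
    rw [mem_range_pend hab]
    rintro ⟨i, hi | hi⟩
    · exact ha ⟨i, hi⟩
    · exact hb ⟨i, hi⟩
  have hadj : T.G.Separates s(a, b) a b := (Separates.adj_iff T.isTree hab).mpr rfl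
  have exists_mem : ∀ c, (T.sideLeaves s(a, b) c).ncard < k →
      ∃ i ∈ I, T.G.Separates s(a, b) (T.leaf i) c := fun c hc => by
    by_contra! hno
    have := Set.ncard_le_ncard (s := (I : Set (Fin n))) (t := T.sideLeaves s(a, b) c)
      (fun i hi => T.mem_sideLeaves.mpr (hno i hi)) (Set.toFinite _)
    rw [Set.ncard_coe_finset] at this
    omega
  have hsplit : T.splits s(a, b) I = 1 := by
    obtain ⟨i, hi, hia⟩ := exists_mem a hA
    obtain ⟨j, hj, hjb⟩ := exists_mem b hB
    refine if_pos ⟨i, hi, j, hj, ?_⟩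
    rw [Separates.right_iff T.connected hadj] at hjb
    exact (Separates.congr_right hjb).mpr hia
  have hsum : T.weightOn (T.ioWeight k a b) I = T.weightOn T.w I + T.w s(a, b) := by
    have h1 : T.weightOn (fun e => if e ∈ Set.range T.pend then T.w s(a, b) / k else 0) I =
        T.w s(a, b) := by
      rw [weightOn_of_pend hn (fun e _ he => if_neg he) (by omega)]
      have hk0 : (k : ℝ) ≠ 0 := by positivity
      simp [hI]
      field_simp
    rw [← h1]
    simp only [weightOn, ← Finset.sum_add_distrib, ← add_mul, ioWeight]
  have := h.D_add hab I
  rw [hsum, hsplit, mul_one, ioWeight, if_neg hnp, add_zero] at this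
  rw [D_eq_weightOn T]
  linarith

end IsContraction

theorem Isom.refl (T : WTree n) : T.Isom T :=
  ⟨Equiv.refl _, fun _ _ => Iff.rfl, fun _ => rfl, fun _ _ => rfl⟩

/-- A contraction may be followed by an isomorphism. -/
theorem IsContraction.comp_isom {T T' Q : WTree n} {a b : T.V} {u : Sym2 T.V → ℝ}
    {φ : T.V → T'.V} (h : T.IsContraction T' a b u φ) (hQ : Q.Isom T') :
    ∃ ψ, T.IsContraction Q a b u ψ := by
  obtain ⟨σ, hadj, hleaf, hw⟩ := hQ
  refine ⟨σ.symm ∘ φ, ⟨σ.symm.surjective.comp h.graph.surjective,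
    congrArg σ.symm h.graph.map_eq, fun x y hxy => h.graph.fiber x y (σ.symm.injective hxy),
    fun u v => ?_⟩, fun i => ?_, fun x y hxy hne => ?_⟩
  · simp only [hadj, h.graph.adj_iff, Function.comp, Equiv.symm_apply_eq]
  · rw [Function.comp, h.leaf, ← hleaf, Equiv.symm_apply_apply]
  · rw [hw]
    simpa using h.weight x y hxy hne

/-- Every essential tree realizing the family arises from the pseudostar `P` realizing it by
`k`-OI operations and insertions of edges of weight `0`. -/
theorem exists_isom_of_realizes {k : ℕ} (hk : 3 ≤ k) (hn : k < n) {D₀ : Finset (Fin n) → ℝ}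
    {P : WTree n} (hPw : P.NonpendantNonzero) (hPe : P.Essential) (hPk : P.IsPseudostar k)
    (hPD : P.Realizes k D₀) (T : WTree n) (hTe : T.Essential) (hTD : T.Realizes k D₀) :
    ∃ Q : WTree n, Relation.ReflTransGen
      (fun A B : WTree n => A.OIStep k B ∨ A.InsertZeroStep B) P Q ∧ Q.Isom T := by
  induction hc : Nat.card T.V using Nat.strong_induction_on generalizing T with | _ c ih
  subst hc
  have hn3 : 3 ≤ n := by omega
  by_cases hTk : T.IsPseudostar k
  · by_cases hTw : T.NonpendantNonzero
    · exact ⟨P, .refl, isom_of_isPseudostar hk hn hPe hPk hPw hTe hTk hTw fun I hI => by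
        rw [hPD I hI, hTD I hI]⟩
    · simp only [NonpendantNonzero] at hTw
      push Not at hTw
      obtain ⟨a, b, hab, ha, hb, hw⟩ := hTw
      obtain ⟨T', φ, h, hT'⟩ := exists_isContraction (by omega) hTe hab ha hb T.w
      obtain ⟨Q, hPQ, hQ⟩ := ih _ (h.card_lt hab) T' hT' (fun I hI => by
        rw [h.D_eq_of_weight_eq_zero hab hw, hTD I hI]) rfl
      obtain ⟨ψ, h'⟩ := h.comp_isom hQ
      exact ⟨T, hPQ.tail (.inr (h'.insertZeroStep hn3 hTe hab ha hb hw)), .refl T⟩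
  · simp only [IsPseudostar] at hTk
    push Not at hTk
    obtain ⟨a, b, hab, hA, hB⟩ := hTk
    have hnotleaf : ∀ {a b}, T.G.Adj a b → (T.sideLeaves s(a, b) b).ncard < k →
        a ∉ Set.range T.leaf := by
      rintro _ b hab hB ⟨i, rfl⟩
      have hsub : {i}ᶜ ⊆ T.sideLeaves s(T.leaf i, b) b := by
        intro j hj
        rw [mem_sideLeaves]
        have hadj := (Separates.adj_iff T.isTree hab).mpr rfl
        rw [Separates.right_iff T.connected hadj, not_not]
        exact T.separates_of_leaf hab fun hji => hj (T.leafInj hji)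
      have := Set.ncard_le_ncard hsub (Set.toFinite _)
      rw [Set.ncard_compl, Set.ncard_singleton, Nat.card_fin] at this
      omega
    have ha := hnotleaf hab hB
    have hb := hnotleaf hab.symm (by rwa [Sym2.eq_swap])
    obtain ⟨T', φ, h, hT'⟩ := exists_isContraction (by omega) hTe hab ha hb (T.ioWeight k a b)
    obtain ⟨Q, hPQ, hQ⟩ := ih _ (h.card_lt hab) T' hT' (fun I hI => by
      rw [h.D_eq_of_ncard_lt hn3 (by omega) hab ha hb hA hB hI, hTD I hI]) rfl
    obtain ⟨ψ, h'⟩ := h.comp_isom hQ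
    exact ⟨T, hPQ.tail (.inl (h'.oiStep hab hA hB)), .refl T⟩

theorem InternalNonzero.nonpendantNonzero {T : WTree n} (h : T.InternalNonzero) (hn : 3 ≤ n)
    (hT : T.Essential) : T.NonpendantNonzero := fun a b hab ha hb =>
  h _ hab (by rw [T.isTwigEdge_iff hn hT hab]; tauto)

end WTree

/-- if `3 ≤ k ≤ n-1`, the family `{D_I}` is l-treelike and `P` is the unique
internal-nonzero-weighted essential pseudostar of kind `(n,k)` realizing it, then every
weighted essential tree with leaf set `[n]` realizing the family is obtained from `P` by a
finite sequence of `k`-OI operations and insertions of internal edges of weight `0`. -/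
theorem statement2 (n k : ℕ) (h3 : 3 ≤ k) (hk : k ≤ n - 1)
    (D₀ : Finset (Fin n) → ℝ) (hD : ∃ T : WTree n, T.Realizes k D₀)
    (P : WTree n)
    (hP : P.InternalNonzero ∧ P.Essential ∧ P.IsPseudostar k ∧ P.Realizes k D₀)
    (T : WTree n) (hTess : T.Essential) (hT : T.Realizes k D₀) :
    ∃ Q : WTree n,
      Relation.ReflTransGen
        (fun A B : WTree n => WTree.OIStep k A B ∨ WTree.InsertZeroStep A B) P Q ∧
      Q.Isom T := by
  obtain ⟨hPw, hPe, hPk, hPD⟩ := hP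
  exact WTree.exists_isom_of_realizes h3 (by omega) (hPw.nonpendantNonzero (by omega) hPe)
    hPe hPk hPD T hTess hT
end

section
/- Let n, k ∈ ℕ with 2 ≤ k ≤ n−2 and let 𝒫 = (P,w) be an internal-nonzero-weighted essential pseudostar of kind (n,k) with leaf set [n]. If for leaves i and l the value D_{{i}∪X}(𝒫) − D_{{l}∪X}(𝒫) does not depend on the choice of the (k−1)-subset X of [n]−{i,l}, then i and l are neighbours. -/
namespace WTree

variable {n : ℕ}

/-- In a tree, an edge lies on the path between two vertices iff it lies on every walk. -/
theorem mem_pathEdges_iff_forall (T : WTree n) {e : Sym2 T.V} {u v : T.V} :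
    e ∈ T.pathEdges u v ↔ ∀ q : T.G.Walk u v, e ∈ q.edges := by
  classical
  constructor
  · rintro ⟨p, hp, he⟩ q
    have hpq : p = q.bypass := by
      have := (T.isTree.isAcyclic.subsingleton_path u v).elim ⟨p, hp⟩
        ⟨q.bypass, q.bypass_isPath⟩
      exact congrArg Subtype.val this
    rw [hpq] at he
    exact q.edges_bypass_subset_edges he
  · intro h
    obtain ⟨p⟩ := T.isTree.connected.preconnected u v
    exact ⟨p.bypass, p.bypass_isPath, h _⟩

theorem mem_pathEdges_iff_mem_edges (T : WTree n) {e : Sym2 T.V} {u v : T.V} {q : T.G.Walk u v}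
    (hq : q.IsPath) : e ∈ T.pathEdges u v ↔ e ∈ q.edges :=
  ⟨fun h => T.mem_pathEdges_iff_forall.1 h q, fun h => ⟨q, hq, h⟩⟩

theorem exists_isPath (T : WTree n) (u v : T.V) : ∃ q : T.G.Walk u v, q.IsPath := by
  classical
  obtain ⟨p⟩ := T.isTree.connected.preconnected u v
  exact ⟨p.bypass, p.bypass_isPath⟩

theorem pathEdges_comm (T : WTree n) (u v : T.V) : T.pathEdges u v = T.pathEdges v u := by
  ext e
  constructor
  all_goals
    rintro ⟨p, hp, he⟩
    exact ⟨p.reverse, hp.reverse, by simpa using he⟩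

theorem notMem_pathEdges_self (T : WTree n) (e : Sym2 T.V) (u : T.V) : e ∉ T.pathEdges u u :=
  fun h => by simpa using T.mem_pathEdges_iff_forall.1 h .nil

theorem mem_edgeSet_of_mem_pathEdges (T : WTree n) {e : Sym2 T.V} {u v : T.V}
    (h : e ∈ T.pathEdges u v) : e ∈ T.G.edgeSet := by
  obtain ⟨p, -, he⟩ := h
  exact p.edges_subset_edgeSet he

theorem mem_pathEdges_or (T : WTree n) {e : Sym2 T.V} {u w : T.V} (h : e ∈ T.pathEdges u w)
    (v : T.V) : e ∈ T.pathEdges u v ∨ e ∈ T.pathEdges v w := by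
  obtain ⟨p, hp⟩ := T.exists_isPath u v
  obtain ⟨q, hq⟩ := T.exists_isPath v w
  have := T.mem_pathEdges_iff_forall.1 h (p.append q)
  rw [SimpleGraph.Walk.edges_append, List.mem_append] at this
  exact this.imp (fun h => ⟨p, hp, h⟩) (fun h => ⟨q, hq, h⟩)

theorem mem_pathEdges_of_adj (T : WTree n) {a b : T.V} (hab : T.G.Adj a b) :
    s(a, b) ∈ T.pathEdges a b :=
  ⟨hab.toWalk, by simp [hab.ne], by simp⟩

/-- Removing the edge `{a, b}` puts every vertex either on the side of `a` or of `b`. -/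
theorem mem_pathEdges_right_iff (T : WTree n) {a b : T.V} (hab : T.G.Adj a b) (v : T.V) :
    s(a, b) ∈ T.pathEdges v b ↔ s(a, b) ∉ T.pathEdges v a := by
  classical
  constructor
  · intro hb ha
    obtain ⟨q, hq⟩ := T.exists_isPath v a
    have he := (T.mem_pathEdges_iff_mem_edges hq).1 ha
    have hbs : b ∈ q.support := q.snd_mem_support_of_mem_edges he
    have h1 := T.mem_pathEdges_iff_forall.1 hb (q.takeUntil b hbs)
    have h2 := (q.takeUntil b hbs).fst_mem_support_of_mem_edges h1
    exact SimpleGraph.Walk.endpoint_notMem_support_takeUntil hq hbs hab.ne h2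
  · intro ha
    rcases T.mem_pathEdges_or (T.mem_pathEdges_of_adj hab) v with h | h
    · exact absurd (T.pathEdges_comm a v ▸ h) ha
    · exact h

/-- Two vertices are separated by an edge iff they are on different sides of it. -/
theorem mem_pathEdges_iff_sides (T : WTree n) {a b : T.V} (hab : T.G.Adj a b) (u v : T.V) :
    s(a, b) ∈ T.pathEdges u v ↔ ¬(s(a, b) ∈ T.pathEdges u a ↔ s(a, b) ∈ T.pathEdges v a) := by
  have hu := T.mem_pathEdges_right_iff hab u
  have hv := T.mem_pathEdges_right_iff hab v
  have h1 : s(a, b) ∈ T.pathEdges u v → s(a, b) ∈ T.pathEdges u a ∨ s(a, b) ∈ T.pathEdges v a :=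
    fun h => T.pathEdges_comm v a ▸ T.mem_pathEdges_or h a
  have h2 : s(a, b) ∈ T.pathEdges u v → s(a, b) ∈ T.pathEdges u b ∨ s(a, b) ∈ T.pathEdges v b :=
    fun h => T.pathEdges_comm v b ▸ T.mem_pathEdges_or h b
  have h3 : s(a, b) ∈ T.pathEdges u a → s(a, b) ∈ T.pathEdges u v ∨ s(a, b) ∈ T.pathEdges v a :=
    fun h => T.mem_pathEdges_or h v
  have h4 : s(a, b) ∈ T.pathEdges v a → s(a, b) ∈ T.pathEdges u v ∨ s(a, b) ∈ T.pathEdges u a :=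
    fun h => T.pathEdges_comm v u ▸ T.mem_pathEdges_or h u
  tauto

theorem notMem_pathEdges_of_mem_of_mem (T : WTree n) {e : Sym2 T.V} {u v w : T.V}
    (h₁ : e ∈ T.pathEdges u v) (h₂ : e ∈ T.pathEdges v w) : e ∉ T.pathEdges u w := by
  have he := T.mem_edgeSet_of_mem_pathEdges h₁
  induction e using Sym2.ind with
  | _ a b =>
    rw [T.mem_pathEdges_iff_sides he] at *
    tauto

theorem mem_pathEdges_of_mem_edge (T : WTree n) {a c x y : T.V} {f : Sym2 T.V}
    (hg : s(a, c) ∈ T.pathEdges x y) (hf : f ∈ T.pathEdges x a) : f ∈ T.pathEdges x y := by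
  classical
  obtain ⟨q, hq, he⟩ := hg
  have ha : a ∈ q.support := q.fst_mem_support_of_mem_edges he
  exact ⟨q, hq, q.edges_takeUntil_subset_edges ha (T.mem_pathEdges_iff_forall.1 hf _)⟩

/-- A path has a unique first edge. -/
theorem eq_of_mem_pathEdges_of_mem_pathEdges (T : WTree n) {b c d y : T.V}
    (hc : s(b, c) ∈ T.pathEdges b y) (hd : s(b, d) ∈ T.pathEdges b y) : c = d := by
  obtain ⟨q, hq⟩ := T.exists_isPath b y
  rw [T.mem_pathEdges_iff_mem_edges hq] at hc hd
  cases q with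
  | nil => simp at hc
  | @cons _ v _ hv q =>
    rw [SimpleGraph.Walk.cons_isPath_iff] at hq
    have key : ∀ z, s(b, z) ∈ (SimpleGraph.Walk.cons hv q).edges → z = v := by
      intro z hz
      rw [SimpleGraph.Walk.edges_cons, List.mem_cons] at hz
      rcases hz with hz | hz
      · exact Sym2.congr_right.1 hz
      · exact absurd (q.fst_mem_support_of_mem_edges hz) hq.2
    rw [key c hc, key d hd]

/-- There is a leaf beyond every edge. -/
theorem exists_leaf_mem_pathEdges (T : WTree n) {a c : T.V} (hac : T.G.Adj a c) :
    ∃ j, s(a, c) ∈ T.pathEdges a (T.leaf j) := by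
  classical
  have := T.fintypeV
  suffices H : ∀ (m : ℕ) (x : T.V) (q : T.G.Walk a x), q.IsPath → s(a, c) ∈ q.edges →
      Fintype.card T.V ≤ q.length + m → ∃ j, s(a, c) ∈ T.pathEdges a (T.leaf j) by
    obtain ⟨q, hq, he⟩ := T.mem_pathEdges_of_adj hac
    exact H _ c q hq he (Nat.le_add_left _ _)
  intro m
  induction m with
  | zero => intro x q hq _ hm; exact absurd hq.length_lt (by omega)
  | succ m ih =>
    intro x q hq he hm
    by_cases hext : ∃ z, T.G.Adj x z ∧ z ∉ q.support
    · obtain ⟨z, hxz, hz⟩ := hext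
      refine ih z (q.concat hxz) (hq.concat hz hxz) ?_ ?_
      · rw [SimpleGraph.Walk.edges_concat]; simp [he]
      · rw [SimpleGraph.Walk.length_concat]; omega
    · push Not at hext
      have hedge : ∀ z, T.G.Adj x z → s(x, z) ∈ T.pathEdges x a := by
        intro z hxz
        have hmem := T.mem_pathEdges_iff_forall.1
          (T.mem_pathEdges_of_adj hxz.symm) (q.dropUntil z (hext z hxz))
        rw [T.pathEdges_comm, Sym2.eq_swap]
        exact ⟨q, hq, q.edges_dropUntil_subset_edges _ hmem⟩
      have hleaf : (T.G.neighborSet x).ncard = 1 := by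
        have hne : ∃ z, T.G.Adj x z := by
          cases hr : q.reverse with
          | nil =>
            have : q.length = 0 := by rw [← q.length_reverse, hr]; rfl
            have h0 : q.edges.length = 0 := by rw [q.length_edges, this]
            rw [List.length_eq_zero_iff.1 h0] at he
            simp at he
          | cons h _ => exact ⟨_, h⟩
        obtain ⟨z, hz⟩ := hne
        rw [Set.ncard_eq_one]
        refine ⟨z, Set.eq_singleton_iff_unique_mem.2 ⟨hz, fun z' hz' => ?_⟩⟩
        exact T.eq_of_mem_pathEdges_of_mem_pathEdges (hedge z' hz') (hedge z hz)
      obtain ⟨j, rfl⟩ := (T.leafSpec x).1 hleaf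
      exact ⟨j, q, hq, he⟩

/-- At a vertex `a` of degree at least three there is a branch with a leaf that avoids both a
given edge `{a, b}` and the branch of a given vertex `x`. -/
theorem exists_leaf_in_third_branch (T : WTree n) {a b x : T.V} (ha : T.IsNode a) :
    ∃ u, s(a, b) ∉ T.pathEdges a (T.leaf u) ∧ T.leaf u ≠ x ∧
      ∀ f ∈ T.pathEdges a x, f ∉ T.pathEdges a (T.leaf u) := by
  classical
  have := T.fintypeV
  obtain ⟨c, hac, hcb, hcx⟩ :
      ∃ c, T.G.Adj a c ∧ c ≠ b ∧ s(a, c) ∉ T.pathEdges a x := by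
    by_contra! hcon
    obtain ⟨p, hp⟩ : ∃ p, ∀ c, T.G.Adj a c → c ≠ b → c = p := by
      by_cases hex : ∃ p, s(a, p) ∈ T.pathEdges a x
      · obtain ⟨p, hp⟩ := hex
        exact ⟨p, fun c hac hcb =>
          T.eq_of_mem_pathEdges_of_mem_pathEdges (hcon c hac hcb) hp⟩
      · exact ⟨b, fun c hac hcb => absurd ⟨c, hcon c hac hcb⟩ hex⟩
    have hsub : T.G.neighborSet a ⊆ {b, p} := fun c hc => by
      by_cases hcb : c = b
      · exact Or.inl hcb
      · exact Or.inr (hp c hc hcb)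
    have h1 := Set.ncard_le_ncard hsub (Set.toFinite _)
    have h2 := (Set.ncard_insert_le b {p}).trans_eq (by rw [Set.ncard_singleton])
    have h3 : 2 < (T.G.neighborSet a).ncard := ha
    omega
  obtain ⟨u, hu⟩ := T.exists_leaf_mem_pathEdges hac
  refine ⟨u, fun hb => hcb (T.eq_of_mem_pathEdges_of_mem_pathEdges hu hb), ?_, ?_⟩
  · rintro rfl
    exact hcx hu
  · intro f hfx hfu
    have hxu := T.notMem_pathEdges_of_mem_of_mem (T.pathEdges_comm a x ▸ hfx) hfu
    rcases T.mem_pathEdges_or hu x with h | h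
    · exact hcx h
    · exact hxu (T.mem_pathEdges_of_mem_edge h (T.pathEdges_comm a x ▸ hfx))

theorem mem_subtreeEdges_insert_of_notMem (T : WTree n) {f : Sym2 T.V} {i l : Fin n}
    (hil : f ∉ T.pathEdges (T.leaf i) (T.leaf l)) {S : Set (Fin n)}
    (hf : f ∈ T.subtreeEdges (insert i S)) : f ∈ T.subtreeEdges (insert l S) := by
  obtain ⟨x, hx, y, hy, hxy⟩ := hf
  rcases hx with rfl | hx <;> rcases hy with rfl | hy
  · exact absurd hxy (T.notMem_pathEdges_self _ _)
  · exact ⟨l, Or.inl rfl, y, Or.inr hy, (T.mem_pathEdges_or hxy (T.leaf l)).resolve_left hil⟩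
  · refine ⟨x, Or.inr hx, l, Or.inl rfl, (T.mem_pathEdges_or hxy (T.leaf l)).resolve_right ?_⟩
    rwa [T.pathEdges_comm]
  · exact ⟨x, Or.inr hx, y, Or.inr hy, hxy⟩

theorem mem_subtreeEdges_insert_congr (T : WTree n) {f : Sym2 T.V} {i l : Fin n}
    (hil : f ∉ T.pathEdges (T.leaf i) (T.leaf l)) (S : Set (Fin n)) :
    f ∈ T.subtreeEdges (insert i S) ↔ f ∈ T.subtreeEdges (insert l S) :=
  ⟨T.mem_subtreeEdges_insert_of_notMem hil,
    T.mem_subtreeEdges_insert_of_notMem (T.pathEdges_comm (T.leaf i) (T.leaf l) ▸ hil)⟩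

theorem D_eq_finsum (T : WTree n) (I : Finset (Fin n)) :
    T.D I = ∑ᶠ e, (T.subtreeEdges ↑I).indicator T.w e := by
  rw [D, finsum_mem_def]

/-- If the paths `i–l` and `u–y` share only the edge `e`, then only `e` contributes to the
mixed second difference of `D`. -/
theorem D_second_difference (T : WTree n) {e : Sym2 T.V} {i l u y : Fin n}
    (hcross : ∀ f ∈ T.pathEdges (T.leaf i) (T.leaf l),
      f ∈ T.pathEdges (T.leaf u) (T.leaf y) → f = e) (X : Finset (Fin n)) :
    T.D (insert i (insert u X)) - T.D (insert l (insert u X)) -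
        (T.D (insert i (insert y X)) - T.D (insert l (insert y X))) =
      (T.subtreeEdges (insert i (insert u ↑X))).indicator T.w e -
        (T.subtreeEdges (insert l (insert u ↑X))).indicator T.w e -
        ((T.subtreeEdges (insert i (insert y ↑X))).indicator T.w e -
          (T.subtreeEdges (insert l (insert y ↑X))).indicator T.w e) := by
  classical
  have := T.fintypeV
  simp only [D_eq_finsum, finsum_eq_sum_of_fintype, ← Finset.sum_sub_distrib, Finset.coe_insert]
  refine Finset.sum_eq_single e (fun f _ hf => ?_) (fun h => absurd (Finset.mem_univ e) h)
  by_cases h1 : f ∈ T.pathEdges (T.leaf i) (T.leaf l)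
  · have h2 : f ∉ T.pathEdges (T.leaf u) (T.leaf y) := fun h2 => hf (hcross f h1 h2)
    have key : ∀ z, f ∈ T.subtreeEdges (insert z (insert u ↑X)) ↔
        f ∈ T.subtreeEdges (insert z (insert y ↑X)) := fun z => by
      rw [Set.insert_comm z u, Set.insert_comm z y]
      exact T.mem_subtreeEdges_insert_congr h2 _
    simp only [Set.indicator_apply, key, sub_self]
  · simp only [Set.indicator_apply, T.mem_subtreeEdges_insert_congr h1, sub_self]

theorem not_isTwigEdge_of_isNode (T : WTree n) {a b : T.V} (hab : T.G.Adj a b)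
    (ha : T.IsNode a) (hb : T.IsNode b) : ¬ T.IsTwigEdge s(a, b) := by
  rintro ⟨_, v, _, p, _, huniq, he⟩
  exact hab.ne ((huniq a (p.fst_mem_support_of_mem_edges he) ha).trans
    (huniq b (p.snd_mem_support_of_mem_edges he) hb).symm)

/-- Across an edge between two nodes with nonzero weight separating the leaves `i` and `l`,
with at least `k` leaves on the side of `i`, the difference of `D` at `i` and `l` is not
constant on `(k - 1)`-subsets. -/
theorem exists_D_sub_ne (T : WTree n) {k : ℕ} (h2 : 2 ≤ k) {a b : T.V} (hab : T.G.Adj a b)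
    (ha : T.IsNode a) (hb : T.IsNode b) (hw : T.w s(a, b) ≠ 0) {i l : Fin n}
    (hia : s(a, b) ∉ T.pathEdges (T.leaf i) a) (hlb : s(a, b) ∉ T.pathEdges (T.leaf l) b)
    (hk : k ≤ (T.sideLeaves s(a, b) a).ncard) :
    ∃ X X' : Finset (Fin n), X.card = k - 1 ∧ X'.card = k - 1 ∧
      i ∉ X ∧ l ∉ X ∧ i ∉ X' ∧ l ∉ X' ∧
      T.D (insert i X) - T.D (insert l X) ≠ T.D (insert i X') - T.D (insert l X') := by
  classical
  obtain ⟨u, hua, hui, hu⟩ := T.exists_leaf_in_third_branch (b := b) (x := T.leaf i) ha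
  obtain ⟨y, hyb, hyl, hy⟩ := T.exists_leaf_in_third_branch (b := a) (x := T.leaf l) hb
  rw [T.pathEdges_comm] at hua
  rw [T.pathEdges_comm, Sym2.eq_swap] at hyb
  have hla : s(a, b) ∈ T.pathEdges (T.leaf l) a := by
    by_contra h
    exact hlb ((T.mem_pathEdges_right_iff hab _).2 h)
  have hya : s(a, b) ∈ T.pathEdges (T.leaf y) a := by
    by_contra h
    exact hyb ((T.mem_pathEdges_right_iff hab _).2 h)
  have sep := fun p q : Fin n => T.mem_pathEdges_iff_sides hab (T.leaf p) (T.leaf q)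
  have hcross : ∀ f ∈ T.pathEdges (T.leaf i) (T.leaf l),
      f ∈ T.pathEdges (T.leaf u) (T.leaf y) → f = s(a, b) := by
    intro f hil huy
    by_contra hne
    have hfab : f ∉ T.pathEdges a b := fun h => by
      have := (T.mem_pathEdges_iff_forall.1 h) hab.toWalk
      simp at this
      exact hne this
    have hxa : ∀ x, f ∈ T.pathEdges x a ↔ f ∈ T.pathEdges x b := fun x =>
      ⟨fun h => (T.mem_pathEdges_or h b).resolve_right (T.pathEdges_comm a b ▸ hfab),
        fun h => (T.mem_pathEdges_or h a).resolve_right hfab⟩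
    rcases T.mem_pathEdges_or hil a with h1 | h1 <;> rcases T.mem_pathEdges_or huy a with h3 | h3
    · exact hu f (T.pathEdges_comm _ a ▸ h1) (T.pathEdges_comm _ a ▸ h3)
    · have hiy := T.notMem_pathEdges_of_mem_of_mem h1 h3
      exact hiy (T.mem_pathEdges_of_mem_edge ((sep i y).2 (by tauto)) h1)
    · rw [T.pathEdges_comm] at h3
      have hlu := T.notMem_pathEdges_of_mem_of_mem (T.pathEdges_comm a _ ▸ h1) h3
      exact hlu (T.mem_pathEdges_of_mem_edge ((sep l u).2 (by tauto))
        (T.pathEdges_comm a _ ▸ h1))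
    · rw [T.pathEdges_comm, hxa, T.pathEdges_comm] at h1 h3
      exact hy f h1 h3
  have hiu : i ≠ u := fun h => hui (h ▸ rfl)
  have hly : l ≠ y := fun h => hyl (h ▸ rfl)
  have hne : ∀ {p q : Fin n}, s(a, b) ∉ T.pathEdges (T.leaf p) a →
      s(a, b) ∈ T.pathEdges (T.leaf q) a → p ≠ q := fun hp hq h => hp (h ▸ hq)
  obtain ⟨X, hXsub, hXcard⟩ : ∃ X ⊆ (T.sideLeaves s(a, b) a).toFinset \ {i, u},
      X.card = k - 2 := by
    refine Finset.exists_subset_card_eq ?_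
    have := Finset.le_card_sdiff {i, u} (T.sideLeaves s(a, b) a).toFinset
    rw [Finset.card_pair hiu, ← Set.ncard_eq_toFinset_card'] at this
    omega
  have hX : ∀ x ∈ X, s(a, b) ∉ T.pathEdges (T.leaf x) a ∧ x ≠ i ∧ x ≠ u := by
    intro x hx
    have := hXsub hx
    rw [Finset.mem_sdiff, Set.mem_toFinset] at this
    simpa [sideLeaves, not_or] using this
  have hiX : i ∉ X := fun h => (hX i h).2.1 rfl
  have huX : u ∉ X := fun h => (hX u h).2.2 rfl
  have hlX : l ∉ X := fun h => (hX l h).1 hla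
  have hyX : y ∉ X := fun h => (hX y h).1 hya
  refine ⟨insert u X, insert y X, ?_, ?_, ?_, ?_, ?_, ?_, ?_⟩
  · rw [Finset.card_insert_of_notMem huX]; omega
  · rw [Finset.card_insert_of_notMem hyX]; omega
  · simp [hiu, hiX]
  · simp [hlX, (hne hua hla).symm]
  · simp [hiX, hne hia hya]
  · simp [hlX, hly]
  · rw [← sub_ne_zero, T.D_second_difference hcross]
    have m1 : s(a, b) ∉ T.subtreeEdges (insert i (insert u ↑X)) := by
      have hside : ∀ x ∈ (insert i (insert u ↑X) : Set (Fin n)),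
          s(a, b) ∉ T.pathEdges (T.leaf x) a := by
        rintro x (rfl | rfl | hx)
        exacts [hia, hua, (hX x hx).1]
      rintro ⟨x, hx, z, hz, hxz⟩
      exact (sep x z).1 hxz (iff_of_false (hside x hx) (hside z hz))
    have m2 : s(a, b) ∈ T.subtreeEdges (insert l (insert u ↑X)) :=
      ⟨l, by simp, u, by simp, (sep l u).2 (by tauto)⟩
    have m3 : s(a, b) ∈ T.subtreeEdges (insert i (insert y ↑X)) :=
      ⟨i, by simp, y, by simp, (sep i y).2 (by tauto)⟩
    rw [Set.indicator_of_notMem m1, Set.indicator_of_mem m2, Set.indicator_of_mem m3,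
      Set.indicator_apply]
    intro h0
    apply hw
    split_ifs at h0 <;> linarith

theorem leaf_deg (T : WTree n) (i : Fin n) : T.deg (T.leaf i) = 1 :=
  (T.leafSpec _).2 ⟨i, rfl⟩

theorem eq_of_adj_leaf (T : WTree n) {i : Fin n} {u v : T.V} (hu : T.G.Adj (T.leaf i) u)
    (hv : T.G.Adj (T.leaf i) v) : u = v := by
  obtain ⟨z, hz⟩ := Set.ncard_eq_one.1 (T.leaf_deg i)
  have hu' : u ∈ T.G.neighborSet (T.leaf i) := hu
  have hv' : v ∈ T.G.neighborSet (T.leaf i) := hv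
  rw [hz] at hu' hv'
  exact hu'.trans hv'.symm

theorem eq_or_eq_of_adj_leaf_leaf (T : WTree n) {i l : Fin n}
    (hil : T.G.Adj (T.leaf i) (T.leaf l)) (j : Fin n) : j = i ∨ j = l := by
  suffices H : ∀ (z : T.V) (q : T.G.Walk (T.leaf i) z), q.IsPath →
      z = T.leaf i ∨ z = T.leaf l by
    obtain ⟨q, hq⟩ := T.exists_isPath (T.leaf i) (T.leaf j)
    exact (H _ q hq).imp (fun h => T.leafInj h) (fun h => T.leafInj h)
  intro z q hq
  cases q with
  | nil => exact Or.inl rfl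
  | cons h₁ q =>
    obtain rfl := T.eq_of_adj_leaf hil h₁
    cases q with
    | nil => exact Or.inr rfl
    | cons h₂ q =>
      obtain rfl := T.eq_of_adj_leaf hil.symm h₂
      simp [SimpleGraph.Walk.cons_isPath_iff] at hq

theorem Essential.isNode_of_adj_of_adj {T : WTree n} (hess : T.Essential) {v x y : T.V}
    (hx : T.G.Adj v x) (hy : T.G.Adj v y) (hxy : x ≠ y) : T.IsNode v := by
  have := T.fintypeV
  have hsub : ({x, y} : Set T.V) ⊆ T.G.neighborSet v := by
    rintro z (rfl | rfl)
    exacts [hx, hy]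
  have h1 := Set.ncard_le_ncard hsub (Set.toFinite _)
  rw [Set.ncard_pair hxy] at h1
  exact lt_of_le_of_ne h1 (hess v).symm

/-- In an essential tree with more than two leaves, two leaves that are not neighbours are
separated by an edge between two nodes. -/
theorem Essential.exists_edge_of_not_neighbours {T : WTree n} (hess : T.Essential) (hn : 2 < n)
    {i l : Fin n} (hil : i ≠ l) (hnb : ¬ T.Neighbours i l) :
    ∃ a b, T.G.Adj a b ∧ T.IsNode a ∧ T.IsNode b ∧
      s(a, b) ∉ T.pathEdges (T.leaf i) a ∧ s(a, b) ∉ T.pathEdges (T.leaf l) b := by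
  have hleaf : ∀ j, ¬ T.IsNode (T.leaf j) := fun j h => by
    rw [IsNode, T.leaf_deg] at h
    omega
  have hnadj : ¬ T.G.Adj (T.leaf i) (T.leaf l) := fun hadj => by
    have hcard : ({i, l} : Finset (Fin n)).card < (Finset.univ : Finset (Fin n)).card := by
      rw [Finset.card_pair hil, Finset.card_univ, Fintype.card_fin]
      exact hn
    obtain ⟨j, -, hj⟩ := Finset.exists_mem_notMem_of_card_lt_card hcard
    exact hj (by simpa using T.eq_or_eq_of_adj_leaf_leaf hadj j)
  suffices H : ∀ (z : T.V) (q : T.G.Walk (T.leaf i) z), q.IsPath → z = T.leaf l →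
      ∃ a b, T.G.Adj a b ∧ T.IsNode a ∧ T.IsNode b ∧
        s(a, b) ∉ T.pathEdges (T.leaf i) a ∧ s(a, b) ∉ T.pathEdges z b by
    obtain ⟨q, hq⟩ := T.exists_isPath (T.leaf i) (T.leaf l)
    exact H _ q hq rfl
  intro z q hq hz
  cases q with
  | nil => exact absurd (T.leafInj hz) hil
  | @cons _ a _ h₁ q =>
    cases q with
    | nil => exact absurd (hz ▸ h₁) hnadj
    | @cons _ b _ h₂ q =>
      have hib : T.leaf i ≠ b := by
        rintro rfl
        simp [SimpleGraph.Walk.cons_isPath_iff] at hq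
      have ha : T.IsNode a := hess.isNode_of_adj_of_adj h₁.symm h₂ hib
      cases q with
      | nil =>
        subst hz
        refine absurd ⟨hil, _, hq, a, ⟨by simp, ha⟩, ?_⟩ hnb
        rintro v ⟨hv, hvn⟩
        simp only [SimpleGraph.Walk.support_cons, SimpleGraph.Walk.support_nil, List.mem_cons,
          List.not_mem_nil, or_false] at hv
        rcases hv with rfl | rfl | rfl
        · exact absurd hvn (hleaf i)
        · rfl
        · exact absurd hvn (hleaf l)
      | @cons _ c _ h₃ q =>
        have hq' := hq.of_cons
        rw [SimpleGraph.Walk.cons_isPath_iff] at hq'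
        have hac : a ≠ c := by
          rintro rfl
          exact hq'.2 (by simp)
        refine ⟨a, b, h₂, ha, hess.isNode_of_adj_of_adj h₂.symm h₃ hac, fun h => ?_, fun h => ?_⟩
        · have := T.mem_pathEdges_iff_forall.1 h h₁.toWalk
          simp only [SimpleGraph.Adj.toWalk, SimpleGraph.Walk.edges_cons,
            SimpleGraph.Walk.edges_nil, List.mem_singleton] at this
          have hmem : b ∈ s(T.leaf i, a) := this ▸ Sym2.mem_mk_right a b
          rcases Sym2.mem_iff.1 hmem with h | h
          · exact hib h.symm
          · exact h₂.ne h.symm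
        · rw [T.pathEdges_comm, T.mem_pathEdges_iff_mem_edges hq'.1] at h
          exact hq'.2 (SimpleGraph.Walk.fst_mem_support_of_mem_edges _ h)

end WTree

/-- if `2 ≤ k ≤ n-2`, `P` is an internal-nonzero-weighted essential
pseudostar of kind `(n,k)` with leaf set `[n]` and `D_{{i}∪X}(P) − D_{{l}∪X}(P)` does not
depend on the `(k-1)`-subset `X` of `[n] - {i,l}`, then `i` and `l` are neighbours. -/
theorem statement5 (n k : ℕ) (h2 : 2 ≤ k) (hk : k ≤ n - 2)
    (P : WTree n) (hinz : P.InternalNonzero) (hess : P.Essential)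
    (hps : P.IsPseudostar k)
    (i l : Fin n) (hil : i ≠ l)
    (h : ∀ X X' : Finset (Fin n), X.card = k - 1 → X'.card = k - 1 →
      i ∉ X → l ∉ X → i ∉ X' → l ∉ X' →
      P.D (insert i X) - P.D (insert l X) = P.D (insert i X') - P.D (insert l X')) :
    P.Neighbours i l := by
  by_contra hnb
  obtain ⟨a, b, hab, ha, hb, hia, hlb⟩ :=
    hess.exists_edge_of_not_neighbours (by omega) hil hnb
  have hw := hinz s(a, b) hab (P.not_isTwigEdge_of_isNode hab ha hb)
  rcases hps a b hab with hk | hk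
  · obtain ⟨X, X', hX, hX', hiX, hlX, hiX', hlX', hne⟩ :=
      P.exists_D_sub_ne h2 hab ha hb hw hia hlb hk
    exact hne (h X X' hX hX' hiX hlX hiX' hlX')
  · rw [Sym2.eq_swap] at hw hia hlb hk
    obtain ⟨X, X', hX, hX', hlX, hiX, hlX', hiX', hne⟩ :=
      P.exists_D_sub_ne h2 hab.symm hb ha hw hlb hia hk
    have := h X X' hX hX' hiX hlX hiX' hlX'
    exact hne (by linarith)
end
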